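/- arXiv:2601.20825 — 2 statements merged into one kernel-verified Lean document; each statement's English description precedes it below -/
import Mathlib

section
/- Construction 1 (optimality): Let q be a prime power, k, δ ≥ 1 integers, n = q^δ(q^k−1)/(q−1), and let C be the convolutional code of Construction 1 (whose stacked coefficient matrix of the generator matrix is the MacDonald generator matrix built from q^δ copies of a simplex generator matrix S(q,k) on top of constant-column blocks X_1, …, X_{q^δ} running over all of F_q^δ). Then C has optimal column distances: there is no delay-free (n,k,δ) convolutional code Ĉ ⊆ F_q[z]^n such that for some j ∈ ℕ0 one has d_j^c(Ĉ) > d_j^c(C) while d_i^c(Ĉ) = d_i^c(C) for all 0 ≤ i < j. -/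
open Finset Polynomial Matrix

noncomputable section

variable {F : Type*} [Field F] [DecidableEq F]

/-- The coefficient vector at time `t` of a polynomial vector `v(z)`. -/
def coeffVec {ι : Type*} (v : ι → Polynomial F) (t : ℕ) : ι → F := fun i => (v i).coeff t

/-- `G(z)` is a generator matrix of the convolutional code `C`:
its rows form a basis of `C`. -/
def IsGenMat {ι : Type*} {k : ℕ} (C : Submodule (Polynomial F) (ι → Polynomial F))
    (G : Matrix (Fin k) ι (Polynomial F)) : Prop :=
  LinearIndependent (Polynomial F) (fun i => G i) ∧
    Submodule.span (Polynomial F) (Set.range fun i => G i) = C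

/-- The `j`-th column distance of a convolutional code. -/
def colDist {ι : Type*} [Fintype ι] (C : Submodule (Polynomial F) (ι → Polynomial F))
    (j : ℕ) : ℕ :=
  sInf { d : ℕ | ∃ v ∈ C, coeffVec v 0 ≠ 0 ∧
      d = ∑ t ∈ Finset.range (j + 1), hammingNorm (coeffVec v t) }

/-- The free distance of a convolutional code. -/
def freeDist {ι : Type*} [Fintype ι] (C : Submodule (Polynomial F) (ι → Polynomial F)) : ℕ :=
  sInf { d : ℕ | ∃ v ∈ C, v ≠ 0 ∧ d = ∑ᶠ t : ℕ, hammingNorm (coeffVec v t) }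

/-- External degree of a polynomial matrix: the sum of its row degrees. -/
def extDeg {ι : Type*} [Fintype ι] {k : ℕ} (G : Matrix (Fin k) ι (Polynomial F)) : ℕ :=
  ∑ i : Fin k, Finset.univ.sup fun j : ι => (G i j).natDegree

/-- Internal degree of a polynomial matrix: the maximal degree of its `k×k` minors. -/
def intDeg {ι : Type*} [Fintype ι] [DecidableEq ι] {k : ℕ}
    (G : Matrix (Fin k) ι (Polynomial F)) : ℕ :=
  Finset.univ.sup fun f : Fin k ↪ ι => ((G.submatrix id fun i => f i).det).natDegree

/-- `C` is an `(n,k,δ)` convolutional code: it has a row-reduced generator matrix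
(with `k` rows, internal degree = external degree) of external degree `δ`. -/
def HasParams {ι : Type*} [Fintype ι] [DecidableEq ι] (k δ : ℕ)
    (C : Submodule (Polynomial F) (ι → Polynomial F)) : Prop :=
  ∃ G : Matrix (Fin k) ι (Polynomial F), IsGenMat C G ∧ intDeg G = extDeg G ∧ extDeg G = δ

/-- `C` is delay-free: some generator matrix `G(z)` has `G(0)` of full row rank `k`. -/
def IsDelayFree {ι : Type*} [Fintype ι] (k : ℕ)
    (C : Submodule (Polynomial F) (ι → Polynomial F)) : Prop :=
  ∃ G : Matrix (Fin k) ι (Polynomial F), IsGenMat C G ∧ (G.map fun p => p.coeff 0).rank = k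

/-- `C` is non-catastrophic: it admits a full-rank parity-check matrix. -/
def IsNoncatastrophic {ι : Type*} [Fintype ι] (k : ℕ)
    (C : Submodule (Polynomial F) (ι → Polynomial F)) : Prop :=
  ∃ H : Matrix (Fin (Fintype.card ι - k)) ι (Polynomial F),
    LinearIndependent (Polynomial F) (fun i => H i) ∧ ∀ v, v ∈ C ↔ H.mulVec v = 0

/-- `padded x t` is `x t` if `t < δ` and `0` otherwise. -/
def padded {δ : ℕ} (x : Fin δ → F) (t : ℕ) : F :=
  if h : t < δ then x ⟨t, h⟩ else 0

/-- A delay-free `(n,k,δ)` convolutional code `C` has optimal column distances if no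
delay-free `(n,k,δ)` convolutional code `C'` satisfies `d_j^c(C') > d_j^c(C)` for some `j`
while `d_i^c(C') = d_i^c(C)` for all `i < j`. -/
def HasOptimalColDist {ι : Type*} [Fintype ι] [DecidableEq ι] (k δ : ℕ)
    (C : Submodule (Polynomial F) (ι → Polynomial F)) : Prop :=
  ¬ ∃ (C' : Submodule (Polynomial F) (ι → Polynomial F)) (j : ℕ),
      HasParams k δ C' ∧ IsDelayFree k C' ∧
      colDist C j < colDist C' j ∧ ∀ i, i < j → colDist C' i = colDist C i

set_option linter.unusedSectionVars false

/-- An affine function with nonzero linear part on a finite space takes nonzero values on a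
proportion `(q - 1) / q` of the points. -/
lemma card_affine_ne_zero [Fintype F] {V : Type*} [AddCommGroup V] [Module F V] [Fintype V]
    (φ : V →ₗ[F] F) (hφ : φ ≠ 0) (a : F) :
    #{y | a + φ y ≠ 0} * Fintype.card F = Fintype.card V * (Fintype.card F - 1) := by
  have hsurj : Function.Surjective φ := LinearMap.surjective hφ
  have hfib : #{y | φ y = -a} * Fintype.card F = Fintype.card V := by
    have h := Finset.card_eq_sum_card_fiberwise (f := φ) (s := univ) (t := univ)
      (fun _ _ => by simp)
    rw [Finset.card_univ, Finset.sum_congr rfl (fun b _ =>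
      AddMonoidHom.card_fiber_eq_of_mem_range φ (hsurj b) (hsurj (-a)))] at h
    rw [h, Finset.sum_const, Finset.card_univ, smul_eq_mul, mul_comm]
  have hcompl : #{y | φ y = -a} + #{y | a + φ y ≠ 0} = Fintype.card V := by
    rw [← Finset.card_univ,
      ← Finset.card_filter_add_card_filter_not (s := univ) (fun y => φ y = -a)]
    simp [eq_neg_iff_add_eq_zero, add_comm]
  obtain ⟨m, hm⟩ := Nat.exists_eq_add_of_le' (Fintype.card_pos (α := F))
  rw [hm] at hfib ⊢
  rw [← hcompl] at hfib ⊢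
  simp only [Nat.add_sub_cancel]
  nlinarith

/-- Double counting of Hamming weights over a finite family of vectors. -/
lemma sum_hammingNorm {V ι : Type*} [Fintype V] [Fintype ι] (f : V → ι → F) :
    ∑ y, hammingNorm (f y) = ∑ p, #{y | f y p ≠ 0} :=
  Finset.sum_card_bipartiteAbove_eq_sum_card_bipartiteBelow (fun y p => f y p ≠ 0)

/-- Total Hamming weight of an affine family all of whose coordinates are nonconstant. -/
lemma sum_hammingNorm_affine [Fintype F] {V ι : Type*} [AddCommGroup V] [Module F V] [Fintype V]
    [Fintype ι] (a : ι → F) (φ : ι → V →ₗ[F] F) (hφ : ∀ p, φ p ≠ 0) :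
    (∑ y, hammingNorm (fun p => a p + φ p y)) * Fintype.card F =
      Fintype.card ι * (Fintype.card V * (Fintype.card F - 1)) := by
  rw [sum_hammingNorm, Finset.sum_mul,
    Finset.sum_congr rfl fun p _ => card_affine_ne_zero (φ p) (hφ p) (a p)]
  simp

/-- The linear functional `u ↦ (u M)_c`. -/
def vecMulCoord {k : ℕ} {ι : Type*} (M : Matrix (Fin k) ι F) (c : ι) : (Fin k → F) →ₗ[F] F :=
  LinearMap.proj c ∘ₗ M.vecMulLinear

lemma vecMulCoord_apply {k : ℕ} {ι : Type*} (M : Matrix (Fin k) ι F) (c : ι) (u : Fin k → F) :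
    vecMulCoord M c u = (u ᵥ* M) c := rfl

lemma vecMulCoord_ne_zero {k : ℕ} {ι : Type*} (M : Matrix (Fin k) ι F) (c : ι) {r : Fin k}
    (h : M r c ≠ 0) : vecMulCoord M c ≠ 0 := by
  intro h0
  apply h
  have := LinearMap.congr_fun h0 (Pi.single r 1)
  simpa [vecMulCoord_apply] using this

lemma card_vecMul_ne_zero_le [Fintype F] {k : ℕ} {ι : Type*} (M : Matrix (Fin k) ι F) (c : ι) :
    #{u | (u ᵥ* M) c ≠ 0} * Fintype.card F ≤
      Fintype.card F ^ k * (Fintype.card F - 1) := by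
  by_cases h : vecMulCoord M c = 0
  · have : ∀ u, (u ᵥ* M) c = 0 := fun u => LinearMap.congr_fun h u
    simp [this]
  · have := card_affine_ne_zero _ h 0
    simp only [zero_add, vecMulCoord_apply] at this
    rw [this]
    simp

/-- Averaging bound on the total weight of a linear block code. -/
lemma sum_hammingNorm_vecMul_le [Fintype F] {k : ℕ} {ι : Type*} [Fintype ι]
    (M : Matrix (Fin k) ι F) :
    (∑ u, hammingNorm (u ᵥ* M)) * Fintype.card F ≤
      Fintype.card ι * (Fintype.card F ^ k * (Fintype.card F - 1)) := by
  rw [sum_hammingNorm, Finset.sum_mul]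
  refine (Finset.sum_le_sum fun c _ => card_vecMul_ne_zero_le M c).trans ?_
  simp

/-- A zero column makes the averaging bound strict. -/
lemma sum_hammingNorm_vecMul_lt [Fintype F] {k : ℕ} {ι : Type*} [Fintype ι]
    (M : Matrix (Fin k) ι F) (c : ι) (hc : ∀ r, M r c = 0) :
    (∑ u, hammingNorm (u ᵥ* M)) * Fintype.card F <
      Fintype.card ι * (Fintype.card F ^ k * (Fintype.card F - 1)) := by
  rw [sum_hammingNorm, Finset.sum_mul]
  refine (Finset.sum_lt_sum (g := fun _ => Fintype.card F ^ k * (Fintype.card F - 1))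
    (fun c _ => card_vecMul_ne_zero_le M c) ⟨c, mem_univ _, ?_⟩).trans_eq ?_
  · have : ∀ u : Fin k → F, (u ᵥ* M) c = 0 := fun u => by simp [vecMul, dotProduct, hc]
    have h1 := Fintype.one_lt_card (α := F)
    have h2 : 0 < Fintype.card F - 1 := by omega
    simp only [this, ne_eq, not_true_eq_false, filter_false, card_empty, zero_mul]
    positivity
  · simp

lemma sum_hammingNorm_vecMul_erase [Fintype F] {k : ℕ} {ι : Type*} [Fintype ι]
    (M : Matrix (Fin k) ι F) :
    ∑ u ∈ univ.erase 0, hammingNorm (u ᵥ* M) = ∑ u, hammingNorm (u ᵥ* M) := by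
  apply Finset.sum_erase
  simp

section BlockCode

variable [Fintype F] {k : ℕ} {ι : Type*} [Fintype ι] {D : ℕ}

lemma sum_hammingNorm_le_sum_const
    (hD : D * (Fintype.card F ^ k - 1) * Fintype.card F =
      Fintype.card ι * (Fintype.card F ^ k * (Fintype.card F - 1)))
    (M : Matrix (Fin k) ι F) :
    ∑ u ∈ univ.erase 0, hammingNorm (u ᵥ* M) ≤
      ∑ _u ∈ (univ.erase 0 : Finset (Fin k → F)), D := by
  have h := sum_hammingNorm_vecMul_le M
  rw [← hD] at h
  have h' := Nat.le_of_mul_le_mul_right h Fintype.card_pos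
  rw [sum_hammingNorm_vecMul_erase]
  simpa [Finset.card_erase_of_mem, mul_comm] using h'

/-- Plotkin-type bound: some nonzero codeword has weight at most the average. -/
lemma exists_hammingNorm_vecMul_le (hk : 1 ≤ k)
    (hD : D * (Fintype.card F ^ k - 1) * Fintype.card F =
      Fintype.card ι * (Fintype.card F ^ k * (Fintype.card F - 1)))
    (M : Matrix (Fin k) ι F) : ∃ u : Fin k → F, u ≠ 0 ∧ hammingNorm (u ᵥ* M) ≤ D := by
  have hne : (univ.erase 0 : Finset (Fin k → F)).Nonempty :=
    ⟨Pi.single ⟨0, hk⟩ 1, by simp⟩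
  obtain ⟨u, hu, h⟩ := Finset.exists_le_of_sum_le hne (sum_hammingNorm_le_sum_const hD M)
  exact ⟨u, by simpa using hu, h⟩

/-- A block code meeting the Plotkin-type bound has constant weight. -/
lemma hammingNorm_vecMul_eq
    (hD : D * (Fintype.card F ^ k - 1) * Fintype.card F =
      Fintype.card ι * (Fintype.card F ^ k * (Fintype.card F - 1)))
    (M : Matrix (Fin k) ι F) (hM : ∀ u : Fin k → F, u ≠ 0 → D ≤ hammingNorm (u ᵥ* M))
    (u : Fin k → F) (hu : u ≠ 0) : hammingNorm (u ᵥ* M) = D := by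
  have hle : ∀ u ∈ (univ.erase 0 : Finset (Fin k → F)), D ≤ hammingNorm (u ᵥ* M) :=
    fun u hu => hM u (by simpa using hu)
  have := (Finset.sum_eq_sum_iff_of_le hle).1
    (le_antisymm (Finset.sum_le_sum hle) (sum_hammingNorm_le_sum_const hD M))
  exact (this u (by simpa using hu)).symm

/-- A block code meeting the Plotkin-type bound has no zero column. -/
lemma exists_entry_ne_zero
    (hD : D * (Fintype.card F ^ k - 1) * Fintype.card F =
      Fintype.card ι * (Fintype.card F ^ k * (Fintype.card F - 1)))
    (M : Matrix (Fin k) ι F) (hM : ∀ u : Fin k → F, u ≠ 0 → D ≤ hammingNorm (u ᵥ* M))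
    (c : ι) : ∃ r, M r c ≠ 0 := by
  by_contra! hc
  have h := sum_hammingNorm_vecMul_lt M c hc
  rw [← hD, ← sum_hammingNorm_vecMul_erase, Finset.sum_congr rfl fun u hu =>
    hammingNorm_vecMul_eq hD M hM u (by simpa using hu)] at h
  simp [Finset.card_erase_of_mem, mul_comm] at h

end BlockCode

section ConvCode

variable {k : ℕ} {ι : Type*}

lemma vecMul_injective_of_rank_eq [Fintype ι] {M : Matrix (Fin k) ι F} (hM : M.rank = k) :
    Function.Injective fun u : Fin k → F => u ᵥ* M := by
  rw [Matrix.vecMul_injective_iff, linearIndependent_iff_card_eq_finrank_span, Fintype.card_fin]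
  rw [rank_eq_finrank_span_row] at hM
  exact hM.symm

lemma coeffVec_zero_sum_smul (u : Fin k → F[X]) (G : Matrix (Fin k) ι F[X]) :
    coeffVec (∑ r, u r • G r) 0 =
      (fun r => (u r).coeff 0) ᵥ* (G.map fun p => p.coeff 0) := by
  funext c
  simp [coeffVec, vecMul, dotProduct, mul_coeff_zero]

lemma colDist_le [Fintype ι] {C : Submodule F[X] (ι → F[X])} {v : ι → F[X]} (hv : v ∈ C)
    (hv0 : coeffVec v 0 ≠ 0) (j : ℕ) :
    colDist C j ≤ ∑ t ∈ Finset.range (j + 1), hammingNorm (coeffVec v t) :=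
  Nat.sInf_le ⟨v, hv, hv0, rfl⟩

lemma le_colDist [Fintype ι] {C : Submodule F[X] (ι → F[X])} {j d : ℕ}
    (hne : ∃ v ∈ C, coeffVec v 0 ≠ 0)
    (h : ∀ v ∈ C, coeffVec v 0 ≠ 0 →
      d ≤ ∑ t ∈ Finset.range (j + 1), hammingNorm (coeffVec v t)) : d ≤ colDist C j := by
  obtain ⟨v, hv, hv0⟩ := hne
  refine le_csInf ⟨_, v, hv, hv0, rfl⟩ ?_
  rintro _ ⟨w, hw, hw0, rfl⟩
  exact h w hw hw0

/-- The codewords `∑ₜ z^(t+1) y_t G(z)` as a linear function of the inputs `y`. -/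
def delayedCodeword (G : Matrix (Fin k) ι F[X]) (j : ℕ) :
    (Fin j → Fin k → F) →ₗ[F] (ι → F[X]) where
  toFun y := ∑ t : Fin j, ∑ r, monomial (t.val + 1) (y t r) • G r
  map_add' y y' := by
    simp [add_smul, Finset.sum_add_distrib]
  map_smul' a y := by
    simp_rw [Pi.smul_apply, ← smul_monomial, smul_assoc, ← Finset.smul_sum, RingHom.id_apply]

lemma delayedCodeword_apply (G : Matrix (Fin k) ι F[X]) (j : ℕ) (y : Fin j → Fin k → F) :
    delayedCodeword G j y = ∑ t : Fin j, ∑ r, monomial (t.val + 1) (y t r) • G r := rfl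

lemma delayedCodeword_mem (G : Matrix (Fin k) ι F[X]) (j : ℕ) (y : Fin j → Fin k → F) :
    delayedCodeword G j y ∈ Submodule.span F[X] (Set.range fun r => G r) := by
  rw [delayedCodeword_apply]
  exact Submodule.sum_mem _ fun _ _ => Submodule.sum_mem _ fun r _ =>
    Submodule.smul_mem _ _ (Submodule.subset_span ⟨r, rfl⟩)

lemma coeffVec_zero_delayedCodeword (G : Matrix (Fin k) ι F[X]) (j : ℕ)
    (y : Fin j → Fin k → F) : coeffVec (delayedCodeword G j y) 0 = 0 := by
  funext c
  simp [coeffVec, delayedCodeword_apply, mul_coeff_zero, coeff_monomial]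

/-- The coefficient at time `s` and position `c` of the delayed codeword. -/
def delayedCoeff (G : Matrix (Fin k) ι F[X]) (j : ℕ) (s : ℕ) (c : ι) :
    (Fin j → Fin k → F) →ₗ[F] F :=
  lcoeff F s ∘ₗ LinearMap.proj c ∘ₗ delayedCodeword G j

lemma delayedCoeff_apply (G : Matrix (Fin k) ι F[X]) (j s : ℕ) (c : ι)
    (y : Fin j → Fin k → F) : delayedCoeff G j s c y = coeffVec (delayedCodeword G j y) s c := rfl

lemma delayedCoeff_ne_zero (G : Matrix (Fin k) ι F[X]) {j : ℕ} (s : Fin j) (c : ι) {r : Fin k}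
    (hr : (G r c).coeff 0 ≠ 0) : delayedCoeff G j (s + 1) c ≠ 0 := by
  intro h
  have h1 := LinearMap.congr_fun h (Pi.single s (Pi.single r 1))
  rw [delayedCoeff_apply, delayedCodeword_apply, Finset.sum_eq_single s, Finset.sum_eq_single r]
    at h1
  · simp only [coeffVec, Pi.single_eq_same, Pi.smul_apply, smul_eq_mul,
      monomial_one_right_eq_X_pow, LinearMap.zero_apply] at h1
    have h2 := coeff_X_pow_mul (G r c) (s.val + 1) 0
    rw [zero_add] at h2
    exact hr (h2.symm.trans h1)
  · intro r' _ hr'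
    simp [Pi.single_eq_of_ne hr']
  · simp
  · intro t _ ht
    simp [Pi.single_eq_of_ne ht]
  · simp

section Averaging

variable [Fintype F] [Fintype ι] {D A : ℕ}
  {C : Submodule F[X] (ι → F[X])} {G : Matrix (Fin k) ι F[X]}

lemma le_hammingNorm_of_le_colDist_zero (hG : IsGenMat C G)
    (hrank : (G.map fun p => p.coeff 0).rank = k) {d : ℕ} (hd : d ≤ colDist C 0)
    (u : Fin k → F) (hu : u ≠ 0) :
    d ≤ hammingNorm (u ᵥ* (G.map fun p => p.coeff 0)) := by
  have hinj := vecMul_injective_of_rank_eq hrank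
  have hv : coeffVec (∑ r, Polynomial.C (u r) • G r) 0 =
      u ᵥ* (G.map fun p => p.coeff 0) := by
    rw [coeffVec_zero_sum_smul]
    simp
  have hmem : ∑ r, Polynomial.C (u r) • G r ∈ C := by
    rw [← hG.2]
    exact Submodule.sum_mem _ fun r _ =>
      Submodule.smul_mem _ _ (Submodule.subset_span ⟨r, rfl⟩)
  have h := colDist_le hmem (by
    rw [hv]
    intro h0
    exact hu (hinj (h0.trans (Matrix.zero_vecMul _).symm))) 0
  rw [zero_add, Finset.sum_range_one, hv] at h
  exact hd.trans h

/-- Averaging over all continuations of a codeword. -/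
lemma sum_weight_delayed (hA : A * Fintype.card F = Fintype.card ι * (Fintype.card F - 1))
    (hcol : ∀ c, ∃ r, (G r c).coeff 0 ≠ 0) (v : ι → F[X]) (j : ℕ) :
    ∑ y, ∑ t ∈ Finset.range (j + 1), hammingNorm (coeffVec (v + delayedCodeword G j y) t) =
      ∑ _y : Fin j → Fin k → F, (hammingNorm (coeffVec v 0) + j * A) := by
  have hadd : ∀ y t, coeffVec (v + delayedCodeword G j y) t =
      fun c => coeffVec v t c + delayedCoeff G j t c y := by
    intro y t
    funext c
    simp [coeffVec, delayedCoeff_apply]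
  have hzero : ∀ y, coeffVec (v + delayedCodeword G j y) 0 = coeffVec v 0 := by
    intro y
    rw [hadd]
    funext c
    rw [delayedCoeff_apply, coeffVec_zero_delayedCodeword]
    simp
  simp_rw [Finset.sum_range_succ' _ j, hzero]
  rw [Finset.sum_add_distrib, Finset.sum_add_distrib, add_comm, Finset.sum_comm]
  congr 1
  rw [← Fin.sum_univ_eq_sum_range
    (fun t => ∑ y, hammingNorm (coeffVec (v + delayedCodeword G j y) (t + 1)))]
  have hs : ∀ s : Fin j, ∑ y, hammingNorm (coeffVec (v + delayedCodeword G j y) (s + 1)) =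
      Fintype.card (Fin j → Fin k → F) * A := by
    intro s
    refine Nat.eq_of_mul_eq_mul_right (Fintype.card_pos (α := F)) ?_
    simp_rw [hadd]
    rw [sum_hammingNorm_affine _ _ (fun c => delayedCoeff_ne_zero G s c (hcol c).choose_spec),
      mul_assoc, hA]
    ring
  rw [Finset.sum_congr rfl fun s _ => hs s]
  simp only [Finset.sum_const, Finset.card_univ, Fintype.card_fin, smul_eq_mul]
  ring

lemma colDist_zero_le
    (hD : D * (Fintype.card F ^ k - 1) * Fintype.card F =
      Fintype.card ι * (Fintype.card F ^ k * (Fintype.card F - 1)))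
    (hG : IsGenMat C G) (hrank : (G.map fun p => p.coeff 0).rank = k)
    (hk : 1 ≤ k) : colDist C 0 ≤ D := by
  obtain ⟨u, hu, h⟩ := exists_hammingNorm_vecMul_le hk hD (G.map fun p => p.coeff 0)
  exact (le_hammingNorm_of_le_colDist_zero hG hrank le_rfl u hu).trans h

lemma sum_weight_continuations
    (hD : D * (Fintype.card F ^ k - 1) * Fintype.card F =
      Fintype.card ι * (Fintype.card F ^ k * (Fintype.card F - 1)))
    (hA : A * Fintype.card F = Fintype.card ι * (Fintype.card F - 1))
    (hG : IsGenMat C G) (hrank : (G.map fun p => p.coeff 0).rank = k)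
    (h0 : D ≤ colDist C 0) {v : ι → F[X]} (hv : v ∈ C)
    (hv0 : coeffVec v 0 ≠ 0) (j : ℕ) :
    ∑ y, ∑ t ∈ Finset.range (j + 1), hammingNorm (coeffVec (v + delayedCodeword G j y) t) =
      ∑ _y : Fin j → Fin k → F, (D + j * A) := by
  have hM := le_hammingNorm_of_le_colDist_zero hG hrank h0
  rw [sum_weight_delayed hA (exists_entry_ne_zero hD _ hM)]
  have hw : hammingNorm (coeffVec v 0) = D := by
    rw [← hG.2, Submodule.mem_span_range_iff_exists_fun] at hv
    obtain ⟨u, rfl⟩ := hv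
    rw [coeffVec_zero_sum_smul] at hv0 ⊢
    refine hammingNorm_vecMul_eq hD _ hM _ fun hu => hv0 ?_
    rw [hu, Matrix.zero_vecMul]
  rw [hw]

lemma colDist_le_continuation
    (hG : IsGenMat C G)
    {v : ι → F[X]} (hv : v ∈ C) (hv0 : coeffVec v 0 ≠ 0) (j : ℕ)
    (y : Fin j → Fin k → F) : colDist C j ≤
      ∑ t ∈ Finset.range (j + 1), hammingNorm (coeffVec (v + delayedCodeword G j y) t) := by
  refine colDist_le (C.add_mem hv (hG.2 ▸ delayedCodeword_mem G j y)) ?_ j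
  have : coeffVec (v + delayedCodeword G j y) 0 = coeffVec v 0 := by
    funext c
    have := congrFun (coeffVec_zero_delayedCodeword G j y) c
    simp only [coeffVec, Pi.zero_apply, Pi.add_apply, coeff_add] at this ⊢
    rw [this, add_zero]
  rwa [this]

/-- Upper bound on the column distances of a code whose zeroth column distance is maximal. -/
lemma colDist_le_of_le_colDist_zero
    (hD : D * (Fintype.card F ^ k - 1) * Fintype.card F =
      Fintype.card ι * (Fintype.card F ^ k * (Fintype.card F - 1)))
    (hA : A * Fintype.card F = Fintype.card ι * (Fintype.card F - 1))
    (hG : IsGenMat C G) (hrank : (G.map fun p => p.coeff 0).rank = k)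
    (h0 : D ≤ colDist C 0) {v : ι → F[X]} (hv : v ∈ C)
    (hv0 : coeffVec v 0 ≠ 0) (j : ℕ) : colDist C j ≤ D + j * A := by
  obtain ⟨y, -, hy⟩ := Finset.exists_le_of_sum_le univ_nonempty
    (sum_weight_continuations hD hA hG hrank h0 hv hv0 j).le
  exact (colDist_le_continuation hG hv hv0 j y).trans hy

/-- If the upper bound on the `j`-th column distance is attained, all truncated codewords have
the same weight. -/
lemma weight_eq_of_le_colDist
    (hD : D * (Fintype.card F ^ k - 1) * Fintype.card F =
      Fintype.card ι * (Fintype.card F ^ k * (Fintype.card F - 1)))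
    (hA : A * Fintype.card F = Fintype.card ι * (Fintype.card F - 1))
    (hG : IsGenMat C G) (hrank : (G.map fun p => p.coeff 0).rank = k)
    (h0 : D ≤ colDist C 0) {j : ℕ} (hj : D + j * A ≤ colDist C j)
    {v : ι → F[X]} (hv : v ∈ C) (hv0 : coeffVec v 0 ≠ 0) :
    ∑ t ∈ Finset.range (j + 1), hammingNorm (coeffVec v t) = D + j * A := by
  have h := (Finset.sum_eq_sum_iff_of_le (s := (univ : Finset (Fin j → Fin k → F)))
    fun y _ => hj.trans (colDist_le_continuation hG hv hv0 j y)).1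
    (sum_weight_continuations hD hA hG hrank h0 hv hv0 j).symm 0 (mem_univ _)
  simpa using h.symm

end Averaging

/-- Rows of any generator matrix of a delay-free code have nonzero constant term. -/
lemma coeffVec_zero_row_ne_zero [Fintype ι] {C : Submodule F[X] (ι → F[X])}
    {G G' : Matrix (Fin k) ι F[X]} (hG : IsGenMat C G)
    (hrank : (G.map fun p => p.coeff 0).rank = k) (hG' : IsGenMat C G') (i : Fin k) :
    coeffVec (G' i) 0 ≠ 0 := by
  intro h0
  have hinj := vecMul_injective_of_rank_eq hrank
  have hmem : G' i ∈ C := hG'.2 ▸ Submodule.subset_span ⟨i, rfl⟩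
  rw [← hG.2, Submodule.mem_span_range_iff_exists_fun] at hmem
  obtain ⟨u, hu⟩ := hmem
  rw [← hu, coeffVec_zero_sum_smul] at h0
  have hu0 := hinj (h0.trans (Matrix.zero_vecMul _).symm)
  have hdvd : ∀ r, X ∣ u r := fun r => X_dvd_iff.2 (congrFun hu0 r)
  choose w hw using hdvd
  have hmem' : ∑ r, w r • G r ∈ C := by
    rw [← hG.2]
    exact Submodule.sum_mem _ fun r _ =>
      Submodule.smul_mem _ _ (Submodule.subset_span ⟨r, rfl⟩)
  rw [← hG'.2, Submodule.mem_span_range_iff_exists_fun] at hmem'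
  obtain ⟨a, ha⟩ := hmem'
  have hrow : ∑ r, (X * a r) • G' r = ∑ r, (Pi.single i 1 : Fin k → F[X]) r • G' r := by
    have : ∑ r, (Pi.single i 1 : Fin k → F[X]) r • G' r = G' i := by
      rw [Finset.sum_eq_single i] <;> simp +contextual
    rw [this, ← hu]
    simp_rw [mul_smul]
    rw [← Finset.smul_sum, ha, Finset.smul_sum]
    exact Finset.sum_congr rfl fun r _ => by rw [hw r, mul_smul]
  have hone := Fintype.linearIndependent_iffₛ.1 hG'.1 _ _ hrow i
  rw [Pi.single_eq_same] at hone
  exact not_isUnit_X (IsUnit.of_mul_eq_one _ hone)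

/-- Some row of a polynomial matrix has degree at most the average. -/
lemma exists_row_natDegree_le [Fintype ι] (hk : 1 ≤ k) (G : Matrix (Fin k) ι F[X]) :
    ∃ i, ∀ c, (G i c).natDegree ≤ extDeg G / k := by
  by_contra! h
  have hlt : ∀ i ∈ (univ : Finset (Fin k)),
      extDeg G / k + 1 ≤ Finset.univ.sup fun c => (G i c).natDegree := by
    intro i _
    obtain ⟨c, hc⟩ := h i
    exact hc.trans_le (Finset.le_sup (f := fun c => (G i c).natDegree) (mem_univ c))
  have hsum := Finset.sum_le_sum hlt
  simp only [Finset.sum_const, Finset.card_univ, Fintype.card_fin, smul_eq_mul] at hsum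
  have : k * (extDeg G / k + 1) ≤ extDeg G := hsum
  exact absurd (Nat.lt_mul_div_succ (extDeg G) hk) (not_lt.2 this)

/-- Codes whose column distances grow maximally up to time `⌊δ/k⌋` are optimal. -/
lemma hasOptimalColDist_of_le_colDist [Fintype F] [Fintype ι] [DecidableEq ι] {D A δ : ℕ}
    (hk : 1 ≤ k)
    (hD : D * (Fintype.card F ^ k - 1) * Fintype.card F =
      Fintype.card ι * (Fintype.card F ^ k * (Fintype.card F - 1)))
    (hA : A * Fintype.card F = Fintype.card ι * (Fintype.card F - 1))
    (C : Submodule F[X] (ι → F[X])) (hC : ∀ j, D + min j (δ / k) * A ≤ colDist C j) :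
    HasOptimalColDist k δ C := by
  rintro ⟨C', j, ⟨G', hG', -, hδ⟩, ⟨G, hG, hrank⟩, hlt, heq⟩
  obtain ⟨i, hi⟩ := exists_row_natDegree_le hk G'
  rw [hδ] at hi
  have hmem : G' i ∈ C' := hG'.2 ▸ Submodule.subset_span ⟨i, rfl⟩
  have hi0 := coeffVec_zero_row_ne_zero hG hrank hG' i
  have hCj := hC j
  rcases Nat.eq_zero_or_pos j with rfl | hj
  · have := colDist_zero_le hD hG hrank hk
    simp at hCj
    omega
  have h0 : D ≤ colDist C' 0 := by
    rw [heq 0 hj]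
    simpa using hC 0
  rcases le_or_gt j (δ / k) with hjν | hjν
  · have := colDist_le_of_le_colDist_zero hD hA hG hrank h0 hmem hi0 j
    rw [min_eq_left hjν] at hCj
    omega
  · have hν : D + δ / k * A ≤ colDist C' (δ / k) := by
      rw [heq _ hjν]
      simpa using hC (δ / k)
    have hw := weight_eq_of_le_colDist hD hA hG hrank h0 hν hmem hi0
    have hle := colDist_le hmem hi0 j
    rw [← Finset.sum_subset (Finset.range_subset_range.2 (Nat.succ_le_succ hjν.le)), hw] at hle
    · rw [min_eq_right hjν.le] at hCj
      omega
    · intro t _ ht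
      have ht' : δ / k < t := by simpa [Nat.lt_succ_iff] using ht
      rw [hammingNorm_eq_zero]
      funext c
      exact coeff_eq_zero_of_natDegree_lt ((hi c).trans_lt ht')

end ConvCode

/-- Lower bound on the weights of the simplex code. -/
lemma le_hammingNorm_simplex [Fintype F] {k Nk K : ℕ}
    (hNk : Nk * (Fintype.card F - 1) = Fintype.card F ^ k - 1)
    (hK : K * Fintype.card F = Fintype.card F ^ k) (S : Matrix (Fin k) (Fin Nk) F)
    (hS1 : ∀ j, (fun i => S i j) ≠ 0)
    (hS2 : ∀ j j', j ≠ j' → ∀ c : F, (fun i => S i j') ≠ c • fun i => S i j)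
    (u : Fin k → F) (hu : u ≠ 0) : K ≤ hammingNorm (u ᵥ* S) := by
  have hq := Fintype.one_lt_card (α := F)
  set φ : (Fin k → F) →ₗ[F] F := vecMulCoord (Matrix.of fun i (_ : Unit) => u i) () with hφdef
  have hφ : ∀ y, φ y = y ⬝ᵥ u := fun y => rfl
  have hφ0 : φ ≠ 0 := by
    obtain ⟨r, hr⟩ := Function.ne_iff.1 hu
    exact vecMulCoord_ne_zero _ _ (r := r) hr
  have hcount := card_affine_ne_zero φ hφ0 0
  simp only [zero_add, Fintype.card_fun, Fintype.card_fin] at hcount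
  have hker : #{y | φ y = 0} + #{y | φ y ≠ 0} = Fintype.card F ^ k := by
    rw [Finset.card_filter_add_card_filter_not]
    simp
  have hz : #{c | (u ᵥ* S) c = 0} + hammingNorm (u ᵥ* S) = Nk := by
    rw [hammingNorm, Finset.card_filter_add_card_filter_not]
    simp
  have hinj : #{c | (u ᵥ* S) c = 0} * (Fintype.card F - 1) + 1 ≤ #{y | φ y = 0} := by
    have h1 : #(({c | (u ᵥ* S) c = 0} : Finset (Fin Nk)) ×ˢ (univ : Finset Fˣ)) ≤
        #(({y | φ y = 0} : Finset (Fin k → F)).erase 0) := by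
      refine Finset.card_le_card_of_injOn (fun p => (p.2 : F) • fun i => S i p.1) ?_ ?_
      · rintro ⟨c, a⟩ hc
        simp only [coe_product, coe_univ, Set.mem_prod, Set.mem_univ, and_true,
          Finset.mem_coe, mem_filter, mem_univ, true_and] at hc
        simp only [coe_erase, Set.mem_sdiff, Set.mem_singleton_iff, Finset.mem_coe, mem_filter,
          mem_univ, true_and]
        refine ⟨?_, ?_⟩
        · rw [map_smul, hφ, dotProduct_comm]
          exact (congrArg _ hc).trans (smul_zero _)
        · exact smul_ne_zero a.ne_zero (hS1 c)
      · rintro ⟨c, a⟩ _ ⟨c', a'⟩ _ h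
        simp only at h
        have hcc : c = c' := by
          by_contra hne
          apply hS2 c c' hne ((a'⁻¹ : Fˣ) * a)
          rw [mul_smul, h, smul_smul, Units.inv_mul, one_smul]
        subst hcc
        have := smul_left_injective F (hS1 c) h
        rw [Units.ext this]
    rw [Finset.card_product, Finset.card_univ, Fintype.card_units,
      Finset.card_erase_of_mem (by simp)] at h1
    have : 0 < #{y | φ y = 0} := Finset.card_pos.2 ⟨0, by simp⟩
    omega
  obtain ⟨m, hm⟩ := Nat.exists_eq_add_of_le' hq.le
  have hqk : 1 ≤ Fintype.card F ^ k := Nat.one_le_pow _ _ (by omega)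
  rw [hm, Nat.add_sub_cancel] at hNk hcount
  rw [hm, Nat.add_sub_cancel] at hinj
  rw [hm] at hK hker hqk
  generalize (m + 1) ^ k = Q at *
  have hNk' : Nk * m + 1 = Q := by omega
  have hmpos : 0 < m := by omega
  generalize #{y | φ y = 0} = z0 at *
  generalize #{y | φ y ≠ 0} = z1 at *
  generalize #{c | (u ᵥ* S) c = 0} = c0 at *
  generalize hammingNorm (u ᵥ* S) = w at *
  have hz0 : z0 = K := by
    have : z0 * (m + 1) = K * (m + 1) := by nlinarith
    exact Nat.eq_of_mul_eq_mul_right (by omega) this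
  refine Nat.le_of_mul_le_mul_right (c := m) ?_ hmpos
  nlinarith

lemma padded_add {δ : ℕ} (y y' : Fin δ → F) (t : ℕ) :
    padded (y + y') t = padded y t + padded y' t := by
  unfold padded
  split_ifs <;> simp

lemma padded_smul {δ : ℕ} (a : F) (y : Fin δ → F) (t : ℕ) :
    padded (a • y) t = a * padded y t := by
  unfold padded
  split_ifs <;> simp

/-- The contribution of past inputs `u` to the output at time `t`, where `p i r` is the state
coordinate that row `r` of the `i`-th coefficient matrix reads. -/
def stateFunctional {k δ : ℕ} (u : Fin k → F[X]) (p : ℕ → Fin k → ℕ) (μ t : ℕ) :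
    (Fin δ → F) →ₗ[F] F where
  toFun y := ∑ i ∈ (Finset.Icc 1 μ).filter (· ≤ t), ∑ r, (u r).coeff (t - i) * padded y (p i r)
  map_add' y y' := by
    simp [padded_add, mul_add, Finset.sum_add_distrib]
  map_smul' a y := by
    simp only [padded_smul, smul_eq_mul, RingHom.id_apply, Finset.mul_sum]
    exact Finset.sum_congr rfl fun _ _ => Finset.sum_congr rfl fun _ _ => by ring

lemma stateFunctional_ne_zero {k δ : ℕ} (u : Fin k → F[X]) (p : ℕ → Fin k → ℕ) {μ t : ℕ}
    (ht1 : 1 ≤ t) (htμ : t ≤ μ) {r : Fin k} (hr : (u r).coeff 0 ≠ 0) (hp : p t r < δ)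
    (hinj : ∀ i ∈ Finset.Icc 1 μ, ∀ r', p i r' = p t r → i = t ∧ r' = r) :
    stateFunctional (δ := δ) u p μ t ≠ 0 := by
  intro h
  have h1 := LinearMap.congr_fun h (Pi.single ⟨p t r, hp⟩ 1)
  have hpad : ∀ n, padded (Pi.single ⟨p t r, hp⟩ 1 : Fin δ → F) n = if n = p t r then 1 else 0 := by
    intro n
    unfold padded
    by_cases hn : n = p t r
    · subst hn
      simp [hp]
    · rw [if_neg hn]
      split_ifs with hnδ
      · exact Pi.single_eq_of_ne (by simpa [Fin.ext_iff] using hn) _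
      · rfl
  simp only [stateFunctional, LinearMap.coe_mk, AddHom.coe_mk, hpad, LinearMap.zero_apply] at h1
  rw [Finset.sum_eq_single t, Finset.sum_eq_single r] at h1
  · simp only [tsub_self, if_true, mul_one] at h1
    exact hr h1
  · intro r' _ hr'
    rw [if_neg, mul_zero]
    exact fun heq => hr' (hinj t (Finset.mem_Icc.2 ⟨ht1, htμ⟩) r' heq).2
  · simp
  · intro i hi hit
    refine Finset.sum_eq_zero fun r' _ => ?_
    rw [if_neg, mul_zero]
    exact fun heq => hit (hinj i (Finset.mem_filter.1 hi).1 r' heq).1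
  · intro hn
    exact (hn (Finset.mem_filter.2 ⟨Finset.mem_Icc.2 ⟨ht1, htμ⟩, le_rfl⟩)).elim

lemma coeff_mul_sum_C_mul_X_pow (f : F[X]) (a : ℕ → F) (μ t : ℕ) :
    (f * ∑ i ∈ Finset.range (μ + 1), Polynomial.C (a i) * X ^ i).coeff t =
      f.coeff t * a 0 +
        ∑ i ∈ (Finset.Icc 1 μ).filter (· ≤ t), f.coeff (t - i) * a i := by
  have hterm : ∀ i, (f * (Polynomial.C (a i) * X ^ i)).coeff t =
      if i ≤ t then f.coeff (t - i) * a i else 0 := by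
    intro i
    rw [← mul_assoc, coeff_mul_X_pow']
    simp
  rw [Finset.mul_sum, finsetSum_coeff, Finset.sum_congr rfl fun i _ => hterm i,
    Finset.sum_filter, Finset.range_eq_Ico, Finset.sum_eq_sum_Ico_succ_bot (Nat.succ_pos μ)]
  simp only [Nat.zero_le, if_true, tsub_zero]
  rfl

/-- Outputs of the encoder as affine functions of the block label. -/
lemma coeffVec_macDonald {k δ μ N Nk : ℕ} (S : Matrix (Fin k) (Fin Nk) F)
    (x : Fin N → Fin δ → F) (Gc : ℕ → Matrix (Fin k) (Fin N × Fin Nk) F)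
    (p : ℕ → Fin k → ℕ) (h0 : ∀ r b c, Gc 0 r (b, c) = S r c)
    (hp : ∀ i ∈ Finset.Icc 1 μ, ∀ r b c, Gc i r (b, c) = padded (x b) (p i r))
    (G : Matrix (Fin k) (Fin N × Fin Nk) F[X])
    (hG : ∀ r c, G r c = ∑ i ∈ Finset.range (μ + 1), Polynomial.C (Gc i r c) * X ^ i)
    (u : Fin k → F[X]) (t : ℕ) (b : Fin N) (c : Fin Nk) :
    coeffVec (∑ r, u r • G r) t (b, c) =
      ((fun r => (u r).coeff t) ᵥ* S) c + stateFunctional u p μ t (x b) := by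
  simp only [coeffVec, Finset.sum_apply, Pi.smul_apply, smul_eq_mul, finsetSum_coeff, hG,
    coeff_mul_sum_C_mul_X_pow, Finset.sum_add_distrib, h0]
  congr 1
  rw [Finset.sum_comm]
  refine Finset.sum_congr rfl fun i hi => Finset.sum_congr rfl fun r _ => ?_
  rw [hp i (Finset.mem_filter.1 hi).1]

lemma hammingNorm_prod {α β : Type*} [Fintype α] [Fintype β] (v : α × β → F) :
    hammingNorm v = ∑ c, #{b | v (b, c) ≠ 0} := by
  simp only [hammingNorm, Finset.card_filter]
  rw [Fintype.sum_prod_type_right]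

/-- The MacDonald-type encoder attains maximal growth of the column distances. -/
lemma le_colDist_macDonald [Fintype F] {k δ μ ν N Nk K A : ℕ} (hk : 1 ≤ k)
    (hNk : Nk * (Fintype.card F - 1) = Fintype.card F ^ k - 1)
    (hK : K * Fintype.card F = Fintype.card F ^ k)
    (hA : A * Fintype.card F = N * Nk * (Fintype.card F - 1))
    (S : Matrix (Fin k) (Fin Nk) F)
    (hS1 : ∀ j, (fun i => S i j) ≠ 0)
    (hS2 : ∀ j j', j ≠ j' → ∀ c : F, (fun i => S i j') ≠ c • fun i => S i j)
    (x : Fin N → Fin δ → F) (hx : Function.Bijective x)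
    (Gc : ℕ → Matrix (Fin k) (Fin N × Fin Nk) F)
    (p : ℕ → Fin k → ℕ) (h0 : ∀ r b c, Gc 0 r (b, c) = S r c)
    (hp : ∀ i ∈ Finset.Icc 1 μ, ∀ r b c, Gc i r (b, c) = padded (x b) (p i r))
    (hν : ν ≤ μ) (hpδ : ∀ t, 1 ≤ t → t ≤ ν → ∀ r, p t r < δ)
    (hinj : ∀ i ∈ Finset.Icc 1 μ, ∀ i' ∈ Finset.Icc 1 μ, ∀ r r', p i' r' < δ →
      p i r = p i' r' → i = i' ∧ r = r')
    (G : Matrix (Fin k) (Fin N × Fin Nk) F[X])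
    (hG : ∀ r c, G r c = ∑ i ∈ Finset.range (μ + 1), Polynomial.C (Gc i r c) * X ^ i) (j : ℕ) :
    N * K + min j ν * A ≤ colDist (Submodule.span F[X] (Set.range fun r => G r)) j := by
  have hqpos := Fintype.card_pos (α := F)
  have hout := coeffVec_macDonald S x Gc p h0 hp G hG
  have hNcard : N = Fintype.card (Fin δ → F) := by
    rw [← Fintype.card_of_bijective hx, Fintype.card_fin]
  have hNpos : 0 < N := hNcard ▸ Fintype.card_pos
  have hKpos : 0 < K := by
    rcases Nat.eq_zero_or_pos K with h | h
    · rw [h, zero_mul] at hK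
      exact absurd hK.symm (pow_pos hqpos k).ne'
    · exact h
  have hstate0 : ∀ u : Fin k → F[X], ∀ y : Fin δ → F, stateFunctional u p μ 0 y = 0 := by
    intro u y
    change ∑ i ∈ (Finset.Icc 1 μ).filter (· ≤ 0), _ = (0 : F)
    refine Finset.sum_eq_zero fun i hi => ?_
    simp only [Finset.mem_filter, Finset.mem_Icc] at hi
    omega
  have hw0 : ∀ u : Fin k → F[X], (fun r => (u r).coeff 0) ≠ 0 →
      N * K ≤ hammingNorm (coeffVec (∑ r, u r • G r) 0) := by
    intro u hu
    have := le_hammingNorm_simplex hNk hK S hS1 hS2 _ hu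
    have hc : ∀ c : Fin Nk, #{b | coeffVec (∑ r, u r • G r) 0 (b, c) ≠ 0} =
        if ((fun r => (u r).coeff 0) ᵥ* S) c ≠ 0 then N else 0 := by
      intro c
      simp only [hout, hstate0, add_zero]
      split_ifs with h <;> simp [h]
    rw [hammingNorm_prod, Finset.sum_congr rfl fun c _ => hc c, ← Finset.sum_filter,
      Finset.sum_const, smul_eq_mul, mul_comm]
    exact Nat.mul_le_mul_right _ this
  have hwt : ∀ u : Fin k → F[X], (fun r => (u r).coeff 0) ≠ 0 → ∀ t, 1 ≤ t → t ≤ ν →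
      A ≤ hammingNorm (coeffVec (∑ r, u r • G r) t) := by
    intro u hu t ht1 htν
    obtain ⟨r, hr⟩ := Function.ne_iff.1 hu
    have hst : stateFunctional (δ := δ) u p μ t ≠ 0 :=
      stateFunctional_ne_zero u p ht1 (htν.trans hν) hr (hpδ t ht1 htν r)
        fun i hi r' h => hinj i hi t (Finset.mem_Icc.2 ⟨ht1, htν.trans hν⟩) r' r
          (hpδ t ht1 htν r) h
    refine Nat.le_of_mul_le_mul_right (c := Fintype.card F) ?_ hqpos
    rw [hA, hammingNorm_prod, Finset.sum_mul]
    have hc : ∀ c : Fin Nk, #{b | coeffVec (∑ r, u r • G r) t (b, c) ≠ 0} * Fintype.card F =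
        N * (Fintype.card F - 1) := by
      intro c
      have h := card_affine_ne_zero _ hst (((fun r => (u r).coeff t) ᵥ* S) c)
      rw [← hNcard] at h
      rw [← h]
      congr 1
      refine Finset.card_bijective x hx fun b => ?_
      simp [hout]
    rw [Finset.sum_congr rfl fun c _ => hc c]
    simp only [Finset.sum_const, Finset.card_univ, Fintype.card_fin, smul_eq_mul]
    exact le_of_eq (by ring)
  refine le_colDist ?_ ?_
  · refine ⟨∑ r, (Pi.single ⟨0, hk⟩ 1 : Fin k → F[X]) r • G r, ?_, ?_⟩
    · exact Submodule.sum_mem _ fun r _ =>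
        Submodule.smul_mem _ _ (Submodule.subset_span ⟨r, rfl⟩)
    · have h := hw0 (Pi.single ⟨0, hk⟩ 1) (Function.ne_iff.2 ⟨⟨0, hk⟩, by simp⟩)
      intro hz
      rw [hz, hammingNorm_zero] at h
      exact absurd h (not_le.2 (Nat.mul_pos hNpos hKpos))
  · intro v hv hv0
    rw [Submodule.mem_span_range_iff_exists_fun] at hv
    obtain ⟨u, rfl⟩ := hv
    have hu : (fun r => (u r).coeff 0) ≠ 0 := by
      intro hu
      rw [coeffVec_zero_sum_smul, hu, Matrix.zero_vecMul] at hv0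
      exact hv0 rfl
    rw [Finset.sum_range_succ', add_comm]
    refine add_le_add ?_ (hw0 u hu)
    calc min j ν * A = ∑ t ∈ Finset.range (min j ν), A := by simp
      _ ≤ ∑ t ∈ Finset.range (min j ν), hammingNorm (coeffVec (∑ r, u r • G r) (t + 1)) := by
        refine Finset.sum_le_sum fun t ht => hwt u hu _ (by omega) ?_
        have := Finset.mem_range.1 ht
        omega
      _ ≤ _ := Finset.sum_le_sum_of_subset
        (Finset.range_subset_range.2 (min_le_left _ _))

open Classical in
/-- The state coordinate read by row `r` of the `i`-th coefficient matrix; the value `δ` means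
that the row is zero. -/
def statePosition {k m : ℕ} (δ μ : ℕ) (e : Fin m → Fin k) (i : ℕ) (r : Fin k) : ℕ :=
  if i < μ then (i - 1) * k + r
  else if h : ∃ s, e s = r then (μ - 1) * k + h.choose else δ

lemma statePosition_of_lt {k m : ℕ} (δ : ℕ) {μ i : ℕ} (e : Fin m → Fin k) (hi : i < μ)
    (r : Fin k) : statePosition δ μ e i r = (i - 1) * k + r :=
  if_pos hi

lemma statePosition_last {k m : ℕ} (δ μ : ℕ) (e : Fin m → Fin k) (r : Fin k) :
    (∃ s, e s = r ∧ statePosition δ μ e μ r = (μ - 1) * k + s) ∨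
      (r ∉ Set.range e ∧ statePosition δ μ e μ r = δ) := by
  unfold statePosition
  rw [if_neg (lt_irrefl μ)]
  by_cases h : ∃ s, e s = r
  · exact Or.inl ⟨h.choose, h.choose_spec, dif_pos h⟩
  · exact Or.inr ⟨h, dif_neg h⟩

lemma statePosition_spec {k m N Nk δ μ : ℕ} (x : Fin N → Fin δ → F) (e : Fin m → Fin k)
    (Gc : ℕ → Matrix (Fin k) (Fin N × Fin Nk) F)
    (hmid : ∀ i, 1 ≤ i → i < μ → ∀ (r : Fin k) (b : Fin N) (c : Fin Nk),
        Gc i r (b, c) = padded (x b) ((i - 1) * k + r.val))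
    (hlast : ∀ (s : Fin m) (b : Fin N) (c : Fin Nk),
        Gc μ (e s) (b, c) = padded (x b) ((μ - 1) * k + s.val))
    (hzero : ∀ r : Fin k, r ∉ Set.range e → Gc μ r = 0) :
    ∀ i ∈ Finset.Icc 1 μ, ∀ r b c,
      Gc i r (b, c) = padded (x b) (statePosition δ μ e i r) := by
  intro i hi r b c
  obtain ⟨hi1, hiμ⟩ := Finset.mem_Icc.1 hi
  rcases hiμ.lt_or_eq with hlt | rfl
  · rw [statePosition_of_lt δ e hlt, hmid i hi1 hlt]
  · rcases statePosition_last δ i e r with ⟨s, rfl, hs⟩ | ⟨hr, hs⟩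
    · rw [hs, hlast]
    · rw [hs, hzero r hr]
      simp [padded]

lemma statePosition_lt {k δ μ : ℕ} (e : Fin (δ + k - k * μ) → Fin k) (he : StrictMono e)
    (hμ : δ ≤ k * μ) {t : ℕ} (ht1 : 1 ≤ t) (ht : t ≤ δ / k) (r : Fin k) :
    statePosition δ μ e t r < δ := by
  have hr := r.isLt
  have htk : t * k ≤ δ := (Nat.mul_le_mul_right k ht).trans (Nat.div_mul_le_self δ k)
  have htμ : t ≤ μ := Nat.le_of_mul_le_mul_left (mul_comm t k ▸ htk.trans hμ) (by omega)
  obtain ⟨t, rfl⟩ : ∃ t', t = t' + 1 := ⟨t - 1, by omega⟩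
  rw [Nat.succ_mul] at htk
  rcases htμ.lt_or_eq with hlt | rfl
  · rw [statePosition_of_lt δ e hlt, Nat.add_sub_cancel]
    omega
  · have hm : δ + k - k * (t + 1) = k := by
      rw [mul_comm, Nat.succ_mul] at hμ ⊢
      omega
    have hsurj : Function.Surjective e :=
      ((Fintype.bijective_iff_injective_and_card e).2 ⟨he.injective, by simp [hm]⟩).2
    rcases statePosition_last δ (t + 1) e r with ⟨s, -, hs⟩ | ⟨hr, -⟩
    · have := s.isLt
      rw [hs, Nat.add_sub_cancel]
      omega
    · exact absurd (hsurj r) hr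

lemma statePosition_inj {k m δ μ : ℕ} (e : Fin m → Fin k) {i i' : ℕ} (hi : i ∈ Finset.Icc 1 μ)
    (hi' : i' ∈ Finset.Icc 1 μ) {r r' : Fin k} (hlt : statePosition δ μ e i' r' < δ)
    (heq : statePosition δ μ e i r = statePosition δ μ e i' r') : i = i' ∧ r = r' := by
  have key : ∀ a a' b b' : ℕ, b < k → b' < k → a * k + b = a' * k + b' → a = a' := by
    intro a a' b b' hb hb' h
    have h1 := congrArg (· / k) h
    simp only [mul_comm _ k] at h1
    rwa [Nat.mul_add_div (by omega), Nat.mul_add_div (by omega), Nat.div_eq_of_lt hb,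
      Nat.div_eq_of_lt hb'] at h1
  have hmix : ∀ a b s : ℕ, a < μ → 1 ≤ a → b < k → (a - 1) * k + b ≠ (μ - 1) * k + s := by
    intro a b s ha ha1 hb
    have := Nat.mul_le_mul_right k (show a - 1 + 1 ≤ μ - 1 by omega)
    rw [Nat.succ_mul] at this
    omega
  obtain ⟨hi1, hiμ⟩ := Finset.mem_Icc.1 hi
  obtain ⟨hi1', hiμ'⟩ := Finset.mem_Icc.1 hi'
  have hr := r.isLt
  have hr' := r'.isLt
  rcases hiμ.lt_or_eq with h | rfl
  · rw [statePosition_of_lt δ e h] at heq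
    rcases hiμ'.lt_or_eq with h' | rfl
    · rw [statePosition_of_lt δ e h'] at heq
      have ha := key _ _ _ _ hr hr' heq
      rw [ha] at heq
      exact ⟨by omega, Fin.ext (by omega)⟩
    · rcases statePosition_last δ i' e r' with ⟨s, -, hs⟩ | ⟨-, hs⟩
      · exact absurd (heq.trans hs) (hmix _ _ _ h hi1 hr)
      · omega
  · rcases statePosition_last δ i e r with ⟨s, hes, hs⟩ | ⟨-, hs⟩
    · rcases hiμ'.lt_or_eq with h' | rfl
      · rw [statePosition_of_lt δ e h', hs] at heq
        exact absurd heq.symm (hmix _ _ _ h' hi1' hr')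
      · rcases statePosition_last δ i' e r' with ⟨s', hes', hs'⟩ | ⟨-, hs'⟩
        · refine ⟨rfl, ?_⟩
          rw [← hes, ← hes']
          exact congrArg e (Fin.ext (by omega))
        · omega
    · omega

/-- **Construction 1 is optimal.** The convolutional code of Construction 1 has optimal
column distances. -/
theorem stmt_9 {F : Type*} [Field F] [Fintype F] [DecidableEq F]
    (q k δ Nk μ : ℕ) (hq : Fintype.card F = q)
    (hk : 1 ≤ k) (hδ : 1 ≤ δ)
    (hNk : Nk * (q - 1) = q ^ k - 1)
    (hμ : μ = (δ + k - 1) / k)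
    (S : Matrix (Fin k) (Fin Nk) F)
    (hS1 : ∀ j, (fun i => S i j) ≠ 0)
    (hS2 : ∀ j j', j ≠ j' → ∀ c : F, (fun i => S i j') ≠ c • fun i => S i j)
    (x : Fin (q ^ δ) → Fin δ → F) (hx : Function.Bijective x)
    (Gc : ℕ → Matrix (Fin k) (Fin (q ^ δ) × Fin Nk) F)
    (e : Fin (δ + k - k * μ) → Fin k) (he : StrictMono e)
    (h0 : ∀ (r : Fin k) (b : Fin (q ^ δ)) (c : Fin Nk), Gc 0 r (b, c) = S r c)
    (hmid : ∀ i, 1 ≤ i → i < μ → ∀ (r : Fin k) (b : Fin (q ^ δ)) (c : Fin Nk),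
        Gc i r (b, c) = padded (x b) ((i - 1) * k + r.val))
    (hlast : ∀ (s : Fin (δ + k - k * μ)) (b : Fin (q ^ δ)) (c : Fin Nk),
        Gc μ (e s) (b, c) = padded (x b) ((μ - 1) * k + s.val))
    (hzero : ∀ r : Fin k, r ∉ Set.range e → Gc μ r = 0)
    (G : Matrix (Fin k) (Fin (q ^ δ) × Fin Nk) (Polynomial F))
    (hG : ∀ r c, G r c = ∑ i ∈ Finset.range (μ + 1), Polynomial.C (Gc i r c) * Polynomial.X ^ i) :
    HasOptimalColDist k δ (Submodule.span (Polynomial F) (Set.range fun r => G r)) := by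
  subst hq
  have hδμ : δ ≤ k * μ := by
    have h1 := Nat.div_add_mod (δ + k - 1) k
    have h2 := Nat.mod_lt (δ + k - 1) hk
    rw [← hμ] at h1
    omega
  obtain ⟨κ, rfl⟩ : ∃ κ, k = κ + 1 := ⟨k - 1, by omega⟩
  obtain ⟨η, rfl⟩ : ∃ η, δ = η + 1 := ⟨δ - 1, by omega⟩
  have hcardι : Fintype.card (Fin (Fintype.card F ^ (η + 1)) × Fin Nk) =
      Fintype.card F ^ (η + 1) * Nk := by simp
  let K := Fintype.card F ^ κ
  let A := Fintype.card F ^ η * (Fintype.card F ^ (κ + 1) - 1)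
  have hK : K * Fintype.card F = Fintype.card F ^ (κ + 1) := (pow_succ _ _).symm
  have hA : A * Fintype.card F =
      Fintype.card F ^ (η + 1) * Nk * (Fintype.card F - 1) := by
    rw [mul_assoc (Fintype.card F ^ (η + 1)), hNk, pow_succ _ η]
    ring
  refine hasOptimalColDist_of_le_colDist (D := Fintype.card F ^ (η + 1) * K) (A := A) hk ?_
    (by rw [hcardι, hA]) _ ?_
  · rw [hcardι, mul_left_comm (Fintype.card F ^ (η + 1) * Nk), mul_assoc _ Nk, hNk, ← hK]
    ring
  exact le_colDist_macDonald hk hNk hK hA S hS1 hS2 x hx Gc (statePosition (η + 1) μ e) h0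
    (statePosition_spec x e Gc hmid hlast hzero)
    (hμ ▸ Nat.div_le_div_right (by omega))
    (fun _ ht1 ht => statePosition_lt e he hδμ ht1 ht)
    (fun _ hi _ hi' _ _ => statePosition_inj e hi hi') G hG
end
end

section
/- Construction 2: Let q be a prime power, δ ≥ 1, k ≥ 2, n = q^{δ+k−1}, μ = ⌈δ/k⌉. Let R ∈ F_q^{(δ+k) × n} be a generator matrix of the first order Reed–Muller code of length q^{δ+k−1}, whose first row is the all-one vector and whose remaining δ+k−1 rows have as columns all vectors of F_q^{δ+k−1}. Let G(z) = ∑_{i=0}^{μ} G_i z^i ∈ F_q[z]^{k×n} where for 0 ≤ i ≤ μ−1, G_i consists of rows ik+1, …, (i+1)k of R, and G_μ has its first kμ−δ rows equal to zero and its remaining δ+k−kμ rows equal to the last δ+k−kμ rows of R. Then the convolutional code C generated by the rows of G(z) is a non-catastrophic (n,k,δ) convolutional code whose column distances are: if δ mod k ≠ k−1, then d_j^c(C) = (min(j, ⌊δ/k⌋)+1)·q^{δ+k−2}·(q−1) for all j ∈ ℕ0; if δ mod k = k−1, then d_j^c(C) = (j+1)·q^{δ+k−2}·(q−1) for j ≤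 ⌊δ/k⌋ and d_j^c(C) = q^{δ+k−1} + ⌊δ/k⌋·q^{δ+k−2}·(q−1) for j ≥ ⌊δ/k⌋ + 1. -/
open Finset Polynomial Matrix

noncomputable section

variable {F : Type*} [Field F] [DecidableEq F]

/-- `rowPad R t` is row `t` of the matrix `R` if `t < m`, and the zero row otherwise. -/
def rowPad {m : ℕ} {ι : Type*} (R : Matrix (Fin m) ι F) (t : ℕ) : ι → F :=
  if h : t < m then R ⟨t, h⟩ else 0

/-- A nonconstant affine function on `F ^ N` has `q ^ (N - 1) * (q - 1)` nonzeros. -/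
lemma card_affine_ne_zero_s15 [Fintype F] {N : ℕ} (b : F) (a : Fin N → F) (ha : a ≠ 0) :
    #{x : Fin N → F | b + ∑ i, a i * x i ≠ 0} =
      Fintype.card F ^ (N - 1) * (Fintype.card F - 1) := by
  obtain ⟨i₀, hi₀⟩ := Function.ne_iff.mp ha
  let f : (Fin N → F) →+ F :=
    { toFun := fun x => ∑ i, a i * x i
      map_zero' := by simp
      map_add' := fun x y => by simp [mul_add, Finset.sum_add_distrib] }
  have hf : ∀ y, y ∈ Set.range f := fun y =>
    ⟨Pi.single i₀ ((a i₀)⁻¹ * y), by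
      have h0 : a i₀ ≠ 0 := hi₀
      simp [f, Pi.single_apply, h0]⟩
  have hfib : ∀ y, #{x : Fin N → F | f x = y} = #{x : Fin N → F | f x = -b} := fun y =>
    AddMonoidHom.card_fiber_eq_of_mem_range f (hf y) (hf (-b))
  have htot : Fintype.card F ^ N = Fintype.card F * #{x : Fin N → F | f x = -b} := by
    have h := Finset.card_eq_sum_card_fiberwise (f := f)
      (s := (Finset.univ : Finset (Fin N → F))) (t := Finset.univ) (fun _ _ => by simp)
    simp only [hfib, Finset.sum_const, Finset.card_univ, smul_eq_mul] at h
    simpa using h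
  have hq : 0 < Fintype.card F := Fintype.card_pos
  have hN : N = N - 1 + 1 := by have := i₀.isLt; omega
  have hfibcard : #{x : Fin N → F | f x = -b} = Fintype.card F ^ (N - 1) := by
    refine (Nat.eq_of_mul_eq_mul_left hq (htot.symm.trans ?_))
    rw [← pow_succ', ← hN]
  have hsplit := Finset.card_filter_add_card_filter_not
    (s := (Finset.univ : Finset (Fin N → F))) (fun x => f x = -b)
  have heq : #{x : Fin N → F | b + ∑ i, a i * x i ≠ 0} = #{x : Fin N → F | ¬ f x = -b} := by
    congr 1
    ext x
    simp only [Finset.mem_filter, Finset.mem_univ, true_and, ne_eq]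
    rw [eq_neg_iff_add_eq_zero, add_comm]
    rfl
  have huniv : #(Finset.univ : Finset (Fin N → F)) = Fintype.card F ^ (N - 1) * Fintype.card F := by
    rw [← pow_succ, ← hN]
    simp
  rw [heq, Nat.mul_sub, mul_one]
  omega

/-- Every codeword of the first order Reed–Muller code that involves a coordinate function has
weight `q ^ (m - 2) * (q - 1)`. -/
lemma hammingNorm_reedMuller [Fintype F] {m : ℕ} (hm : 0 < m) {ι : Type*} [Fintype ι]
    (R : Matrix (Fin m) ι F) (hR1 : ∀ j, R ⟨0, hm⟩ j = 1)
    (hR2 : Function.Bijective fun j : ι =>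
      (fun r : Fin (m - 1) => R ⟨r.val + 1, by have := r.isLt; omega⟩ j))
    (a : Fin m → F) (i : Fin m) (hi : i.val ≠ 0) (ha : a i ≠ 0) :
    hammingNorm (fun c => ∑ s, a s * R s c) =
      Fintype.card F ^ (m - 2) * (Fintype.card F - 1) := by
  obtain ⟨N, rfl⟩ : ∃ N, m = N + 1 := ⟨m - 1, by omega⟩
  have hne : (fun r : Fin N => a r.succ) ≠ 0 := by
    intro h
    have hi0 : i ≠ 0 := fun h0 => hi (by simp [h0])
    obtain ⟨r, rfl⟩ := Fin.exists_succ_eq.mpr hi0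
    exact ha (congrFun h r)
  have hcard := card_affine_ne_zero_s15 (a 0) (fun r : Fin N => a r.succ) hne
  have hN : N + 1 - 2 = N - 1 := by omega
  rw [hN, ← hcard, hammingNorm]
  refine Finset.card_bijective _ hR2 fun c => ?_
  simp only [Finset.mem_filter, Finset.mem_univ, true_and]
  rw [Fin.sum_univ_succ]
  have h0 : R 0 c = 1 := hR1 c
  rw [h0, mul_one]
  rfl

/-- Evaluation points at which the rows of the Reed–Muller generator matrix form a unitriangular
matrix: the origin, followed by the unit vectors. -/
lemma exists_points_reedMuller {K : Type*} [Field K] {m : ℕ} (hm : 0 < m) {ι : Type*}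
    (R : Matrix (Fin m) ι K) (hR1 : ∀ j, R ⟨0, hm⟩ j = 1)
    (hR2 : Function.Bijective fun j : ι =>
      (fun r : Fin (m - 1) => R ⟨r.val + 1, by have := r.isLt; omega⟩ j)) :
    ∃ p : Fin m → ι, ∀ a b, R a (p b) = if a = b ∨ a.val = 0 then 1 else 0 := by
  choose p hp using fun b : Fin m => hR2.2 (fun r => if r.val + 1 = b.val then 1 else 0)
  refine ⟨p, fun a b => ?_⟩
  by_cases ha : a.val = 0
  · have : a = ⟨0, hm⟩ := Fin.ext ha
    subst this
    simp [hR1]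
  · have h := congrFun (hp b) ⟨a.val - 1, by omega⟩
    have hidx : (⟨a.val - 1 + 1, by omega⟩ : Fin m) = a := Fin.ext (by simp; omega)
    simp only [hidx] at h
    rw [h]
    have : a.val - 1 + 1 = a.val := by omega
    simp [ha, this, Fin.ext_iff]

/-- A polynomial matrix whose row module has a polynomial retraction has independent rows and
generates a non-catastrophic code. -/
lemma isNoncatastrophic_of_retraction {E : Type*} [Field E] {ι : Type*} [Fintype ι] {k : ℕ}
    (G : Matrix (Fin k) ι (Polynomial E))
    (π : (ι → Polynomial E) →ₗ[Polynomial E] (Fin k → Polynomial E))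
    (hπ : ∀ u : Fin k → Polynomial E, π (∑ r, u r • G r) = u) :
    LinearIndependent (Polynomial E) (fun r => G r) ∧
      IsNoncatastrophic k (Submodule.span (Polynomial E) (Set.range fun r => G r)) := by
  classical
  let g : (Fin k → Polynomial E) →ₗ[Polynomial E] (ι → Polynomial E) :=
    Fintype.linearCombination (Polynomial E) (fun r => G r)
  have hg : ∀ u, g u = ∑ r, u r • G r := fun u => Fintype.linearCombination_apply _ _ _
  have hπg : ∀ u, π (g u) = u := fun u => by rw [hg, hπ]
  have hli : LinearIndependent (Polynomial E) (fun r => G r) := by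
    rw [Fintype.linearIndependent_iff]
    intro u hu r
    have := hπ u
    rw [hu, map_zero] at this
    exact (congrFun this r).symm
  refine ⟨hli, ?_⟩
  let K := LinearMap.ker π
  have hsurj : Function.Surjective π := fun u => ⟨g u, hπg u⟩
  have hrank : Module.finrank (Polynomial E) K = Fintype.card ι - k := by
    have h := Submodule.finrank_quotient_add_finrank K
    rw [(π.quotKerEquivOfSurjective hsurj).finrank_eq] at h
    simp only [Module.finrank_fintype_fun_eq_card, Fintype.card_fin] at h
    omega
  let b := Module.finBasisOfFinrankEq (Polynomial E) K hrank
  let s : (ι → Polynomial E) →ₗ[Polynomial E] K :=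
    (LinearMap.id - g ∘ₗ π).codRestrict K (fun v => by simp [K, hπg])
  have hs : ∀ v : K, s v = v := fun v => by
    have hv : π v = 0 := v.2
    ext1
    simp [s, hv]
  let h : (ι → Polynomial E) →ₗ[Polynomial E] (Fin (Fintype.card ι - k) → Polynomial E) :=
    b.equivFun.toLinearMap ∘ₗ s
  have hh : Function.Surjective h := fun w => ⟨(b.equivFun.symm w : K), by
    simp only [h, LinearMap.comp_apply, hs, LinearEquiv.coe_coe, LinearEquiv.apply_symm_apply]⟩
  refine ⟨LinearMap.toMatrix' h, ?_, fun v => ?_⟩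
  · rw [Fintype.linearIndependent_iff]
    intro c hc i
    obtain ⟨v, hv⟩ := hh (Pi.single i 1)
    have hc' : c ᵥ* (LinearMap.toMatrix' h) = 0 := by
      rw [Matrix.vecMul_eq_sum]
      exact hc
    have h1 : c ⬝ᵥ (LinearMap.toMatrix' h *ᵥ v) = 0 := by
      rw [Matrix.dotProduct_mulVec, hc', zero_dotProduct]
    rw [LinearMap.toMatrix'_mulVec, hv] at h1
    simpa using h1
  · rw [LinearMap.toMatrix'_mulVec, Submodule.mem_span_range_iff_exists_fun]
    have hker : h v = 0 ↔ v = g (π v) := by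
      simp only [h, LinearMap.comp_apply, LinearEquiv.coe_coe, map_eq_zero_iff b.equivFun
        b.equivFun.injective]
      rw [← Subtype.coe_inj]
      simp [s, sub_eq_zero]
    rw [hker]
    constructor
    · rintro ⟨u, rfl⟩
      rw [hπ, hg]
    · intro hv
      exact ⟨π v, by rw [← hg]; exact hv.symm⟩

/-- The coefficient of a product at the sum of degree bounds of the factors. -/
lemma coeff_prod_sum_of_natDegree_le {K : Type*} [Field K] {α : Type*} (s : Finset α) (f : α → Polynomial K)
    (d : α → ℕ) (hd : ∀ i, (f i).natDegree ≤ d i) :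
    (∏ i ∈ s, f i).coeff (∑ i ∈ s, d i) = ∏ i ∈ s, (f i).coeff (d i) := by
  classical
  induction s using Finset.induction_on with
  | empty => simp
  | insert i s hi ih =>
    rw [Finset.prod_insert hi, Finset.sum_insert hi, Finset.prod_insert hi, ← ih]
    exact coeff_mul_add_eq_of_natDegree_le (hd i)
      ((natDegree_prod_le _ _).trans (Finset.sum_le_sum fun j _ => hd j))

/-- The coefficient of a determinant at the sum of row degree bounds is the determinant of the
leading row coefficients. -/
lemma coeff_det_sum_rowDegree {K : Type*} [Field K] {k : ℕ} (M : Matrix (Fin k) (Fin k) (Polynomial K)) (d : Fin k → ℕ)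
    (hd : ∀ r c, (M r c).natDegree ≤ d r) :
    M.det.coeff (∑ r, d r) = (Matrix.of fun r c => (M r c).coeff (d r)).det := by
  rw [← Matrix.det_transpose M, ← Matrix.det_transpose (Matrix.of _), Matrix.det_apply',
    Matrix.det_apply', finsetSum_coeff]
  refine Finset.sum_congr rfl fun σ _ => ?_
  simp only [Matrix.transpose_apply, Matrix.of_apply]
  rw [← coeff_prod_sum_of_natDegree_le _ (fun r => M r (σ r)) d (fun r => hd _ _),
    ← C_eq_intCast, coeff_C_mul]

lemma natDegree_det_le_sum_rowDegree {K : Type*} [Field K] {k : ℕ} (M : Matrix (Fin k) (Fin k) (Polynomial K))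
    (d : Fin k → ℕ) (hd : ∀ r c, (M r c).natDegree ≤ d r) :
    M.det.natDegree ≤ ∑ r, d r := by
  rw [← Matrix.det_transpose, Matrix.det_apply']
  refine natDegree_sum_le_of_forall_le _ _ fun σ _ => ?_
  refine natDegree_mul_le.trans ?_
  rw [natDegree_intCast, zero_add]
  exact (natDegree_prod_le _ _).trans (Finset.sum_le_sum fun r _ => hd _ _)

/-- A matrix whose leading row coefficient matrix has a nonzero maximal minor is row-reduced. -/
lemma intDeg_extDeg_of_leading_minor {E : Type*} [Field E] {ι : Type*} [Fintype ι] [DecidableEq ι] {k : ℕ}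
    (G : Matrix (Fin k) ι (Polynomial E)) (d : Fin k → ℕ)
    (hd : ∀ r c, (G r c).natDegree ≤ d r) (f : Fin k ↪ ι)
    (hdiag : ∀ r, (G r (f r)).coeff (d r) ≠ 0)
    (hdet : (Matrix.of fun r s => (G r (f s)).coeff (d r)).det ≠ 0) :
    intDeg G = ∑ r, d r ∧ extDeg G = ∑ r, d r := by
  constructor
  · apply le_antisymm
    · exact Finset.sup_le fun f' _ => natDegree_det_le_sum_rowDegree _ d fun r c => hd _ _
    · refine le_trans ?_ (Finset.le_sup (Finset.mem_univ f))
      apply le_natDegree_of_ne_zero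
      rw [coeff_det_sum_rowDegree (G.submatrix id fun i => f i) d (fun r c => hd r (f c))]
      exact hdet
  · refine Finset.sum_congr rfl fun r _ => le_antisymm (Finset.sup_le fun c _ => hd r c) ?_
    exact (le_natDegree_of_ne_zero (hdiag r)).trans
      (Finset.le_sup (f := fun j => (G r j).natDegree) (Finset.mem_univ (f r)))

/-- The rows `0, …, δ + k - 1` are distributed over the coefficient matrices: row `a` occurs in
the coefficient of degree `I a`, at position `ρ a`. -/
lemma exists_stacking_index (k δ μ : ℕ) (hk : 0 < k) (h1 : δ ≤ k * μ) :
    ∃ (I : Fin (δ + k) → ℕ) (ρ : Fin (δ + k) → Fin k), (∀ a, I a ≤ μ) ∧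
      (∀ t < μ, ∀ r a, (I a = t ∧ ρ a = r) ↔ a.val = t * k + r.val) ∧
      (∀ r a, (I a = μ ∧ ρ a = r) ↔ (k * μ - δ ≤ r.val ∧ a.val = r.val + δ)) := by
  have hdiv : ∀ a, a < k * μ → a / k < μ := fun a ha => Nat.div_lt_of_lt_mul ha
  refine ⟨fun a => if a.val < k * μ then a.val / k else μ,
    fun a => ⟨if a.val < k * μ then a.val % k else a.val - δ, ?_⟩, fun a => ?_,
    fun t ht r a => ?_, fun r a => ?_⟩
  · split_ifs
    · exact Nat.mod_lt _ hk
    · omega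
  · dsimp only
    split_ifs with h
    · exact (hdiv _ h).le
    · exact le_rfl
  · simp only [Fin.ext_iff]
    split_ifs with h
    · rw [Nat.div_mod_unique hk, mul_comm k t, add_comm]
      exact ⟨fun h => h.1.symm, fun h => ⟨h.symm, r.isLt⟩⟩
    · have : t * k + r.val < k * μ := by nlinarith [r.isLt]
      omega
  · simp only [Fin.ext_iff]
    split_ifs with h
    · have := hdiv _ h
      omega
    · omega

/-- Codewords of the stacked code, expanded in the rows of the underlying block matrix. -/
lemma sum_smul_stacked {E : Type*} [Field E] {k δ μ : ℕ} {ι : Type*} (R : Matrix (Fin (δ + k)) ι E)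
    (h2 : k * μ < δ + k) (I : Fin (δ + k) → ℕ) (ρ : Fin (δ + k) → Fin k) (hI : ∀ a, I a ≤ μ)
    (hlow : ∀ t < μ, ∀ r a, (I a = t ∧ ρ a = r) ↔ a.val = t * k + r.val)
    (htop : ∀ r a, (I a = μ ∧ ρ a = r) ↔ (k * μ - δ ≤ r.val ∧ a.val = r.val + δ))
    (Gc : ℕ → Matrix (Fin k) ι E)
    (hstack : ∀ i, i < μ → ∀ r : Fin k, Gc i r = rowPad R (i * k + r.val))
    (hzero : ∀ r : Fin k, r.val < k * μ - δ → Gc μ r = 0)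
    (hlastrows : ∀ r : Fin k, k * μ - δ ≤ r.val → Gc μ r = rowPad R (r.val + δ))
    (G : Matrix (Fin k) ι (Polynomial E))
    (hG : ∀ r c, G r c = ∑ i ∈ Finset.range (μ + 1), Polynomial.C (Gc i r c) * Polynomial.X ^ i)
    (u : Fin k → Polynomial E) (c : ι) :
    (∑ r, u r • G r) c = ∑ a, X ^ I a * u (ρ a) * C (R a c) := by
  have hGc : ∀ t ∈ Finset.range (μ + 1), ∀ r,
      Gc t r c = ∑ a, if I a = t ∧ ρ a = r then R a c else 0 := by
    intro t ht r
    rcases (Nat.lt_succ_iff.mp (Finset.mem_range.mp ht)).lt_or_eq with ht | rfl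
    · have hlt : t * k + r.val < δ + k := by nlinarith [r.isLt]
      have : ∀ a : Fin (δ + k), a.val = t * k + r.val ↔ a = ⟨t * k + r.val, hlt⟩ := fun a => by
        rw [Fin.ext_iff]
      simp [hlow t ht, this, hstack t ht, rowPad, hlt]
    · by_cases hr : k * t - δ ≤ r.val
      · have hlt : r.val + δ < δ + k := by omega
        have : ∀ a : Fin (δ + k), a.val = r.val + δ ↔ a = ⟨r.val + δ, hlt⟩ := fun a => by
          rw [Fin.ext_iff]
        simp [htop, hr, this, hlastrows, rowPad, hlt]
      · simp [htop, hr, hzero r (not_le.mp hr)]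
  have hGa : ∀ r, G r c = ∑ a, if ρ a = r then C (R a c) * X ^ I a else 0 := by
    intro r
    rw [hG]
    calc _ = ∑ t ∈ Finset.range (μ + 1), ∑ a,
            (if I a = t then if ρ a = r then C (R a c) * X ^ I a else 0 else 0) := by
          refine Finset.sum_congr rfl fun t ht => ?_
          rw [hGc t ht r, map_sum, Finset.sum_mul]
          refine Finset.sum_congr rfl fun a _ => ?_
          by_cases h1 : I a = t <;> by_cases h3 : ρ a = r <;> simp [h1, h3]
      _ = _ := by
          rw [Finset.sum_comm]
          refine Finset.sum_congr rfl fun a _ => ?_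
          have : I a ∈ Finset.range (μ + 1) := Finset.mem_range.mpr (Nat.lt_succ_of_le (hI a))
          rw [Finset.sum_ite_eq, if_pos this]
  simp only [Finset.sum_apply, Pi.smul_apply, smul_eq_mul, hGa, Finset.mul_sum]
  rw [Finset.sum_comm]
  refine Finset.sum_congr rfl fun a _ => ?_
  simp only [mul_ite, mul_zero, Finset.sum_ite_eq, Finset.mem_univ, if_true]
  ring

/-- The message is recovered linearly from a codeword by evaluating at the origin and at unit
vectors. -/
lemma exists_retraction_stacked {E : Type*} [Field E] {k m : ℕ} (hm : 0 < m) (hkm : k ≤ m)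
    {ι : Type*} (R : Matrix (Fin m) ι E) (p : Fin m → ι)
    (hp : ∀ a b, R a (p b) = if a = b ∨ a.val = 0 then 1 else 0)
    (I : Fin m → ℕ) (ρ : Fin m → Fin k)
    (hbot : ∀ r a, (I a = 0 ∧ ρ a = r) ↔ a.val = r.val)
    (G : Matrix (Fin k) ι (Polynomial E))
    (hcomb : ∀ (u : Fin k → Polynomial E) c,
      (∑ r, u r • G r) c = ∑ a, X ^ I a * u (ρ a) * C (R a c)) :
    ∃ π : (ι → Polynomial E) →ₗ[Polynomial E] (Fin k → Polynomial E),
      ∀ u : Fin k → Polynomial E, π (∑ r, u r • G r) = u := by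
  let ev : ι → (ι → Polynomial E) →ₗ[Polynomial E] Polynomial E := LinearMap.proj
  have hev : ∀ c v, ev c v = v c := fun c v => rfl
  refine ⟨LinearMap.pi fun r => if r.val = 0 then ev (p ⟨0, hm⟩)
    else ev (p ⟨r.val, by omega⟩) - ev (p ⟨0, hm⟩), fun u => ?_⟩
  ext1 r
  obtain ⟨hI0, hρ⟩ := (hbot r ⟨r.val, by omega⟩).mpr rfl
  have hdelta : ∀ a : Fin m, (if a = ⟨r.val, by omega⟩ then (1 : E) else 0) =
      if r.val = 0 then R a (p ⟨0, hm⟩) else R a (p ⟨r.val, by omega⟩) - R a (p ⟨0, hm⟩) := by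
    intro a
    simp only [hp, Fin.ext_iff]
    split_ifs <;> simp_all
  have hrec : ∑ a, X ^ I a * u (ρ a) *
      C (if a = ⟨r.val, by omega⟩ then (1 : E) else 0) = u r := by
    rw [Finset.sum_eq_single ⟨r.val, by omega⟩]
    · simp [hI0, hρ]
    · intro a _ ha
      simp [ha]
    · simp
  rw [LinearMap.pi_apply, ← hrec]
  simp only [hdelta]
  by_cases hr : r.val = 0
  · simp only [hr, if_true, hev, hcomb]
  · simp only [hr, if_false, LinearMap.sub_apply, hev, hcomb, C_sub,
      mul_sub, Finset.sum_sub_distrib]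

/-- The stacked generator matrix is row-reduced of external degree `δ`. -/
lemma intDeg_extDeg_stacked {k δ μ : ℕ} {ι : Type*} [Fintype ι] [DecidableEq ι]
    (R : Matrix (Fin (δ + k)) ι F) (hμ : 0 < μ)
    (h1 : δ ≤ k * μ) (h2 : k * μ < δ + k) (p : Fin (δ + k) → ι)
    (hp : ∀ a b, R a (p b) = if a = b ∨ a.val = 0 then 1 else 0)
    (Gc : ℕ → Matrix (Fin k) ι F)
    (hstack : ∀ i, i < μ → ∀ r : Fin k, Gc i r = rowPad R (i * k + r.val))
    (hzero : ∀ r : Fin k, r.val < k * μ - δ → Gc μ r = 0)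
    (hlastrows : ∀ r : Fin k, k * μ - δ ≤ r.val → Gc μ r = rowPad R (r.val + δ))
    (G : Matrix (Fin k) ι (Polynomial F))
    (hcoeff : ∀ r c t, (G r c).coeff t = if t ≤ μ then Gc t r c else 0) :
    intDeg G = δ ∧ extDeg G = δ := by
  let d : Fin k → ℕ := fun r => if r.val < k * μ - δ then μ - 1 else μ
  have hkμ : (μ - 1) * k + k = k * μ := by
    obtain ⟨ν, rfl⟩ : ∃ ν, μ = ν + 1 := ⟨μ - 1, by omega⟩
    simp only [Nat.add_sub_cancel]
    ring
  let ℓ : Fin k → Fin (δ + k) := fun r =>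
    ⟨if r.val < k * μ - δ then (μ - 1) * k + r.val else r.val + δ, by split_ifs <;> omega⟩
  have hℓ : StrictMono ℓ := fun r s hrs => by
    have : r.val < s.val := hrs
    have := r.isLt
    simp only [ℓ, Fin.lt_def]
    split_ifs <;> omega
  have hlead : ∀ r c, (G r c).coeff (d r) = R (ℓ r) c := by
    intro r c
    rw [hcoeff]
    by_cases hr : r.val < k * μ - δ
    · have hlt : (μ - 1) * k + r.val < δ + k := by omega
      simp [d, ℓ, hr, hstack (μ - 1) (by omega), rowPad, hlt]
    · have hlt : r.val + δ < δ + k := by omega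
      simp [d, ℓ, hr, hlastrows r (not_lt.mp hr), rowPad, hlt]
  have hdeg : ∀ r c, (G r c).natDegree ≤ d r := by
    intro r c
    rw [natDegree_le_iff_coeff_eq_zero]
    intro t ht
    rw [hcoeff]
    split_ifs with htμ
    · by_cases hr : r.val < k * μ - δ
      · have hd : d r = μ - 1 := if_pos hr
        have : t = μ := by omega
        simp [this, hzero r hr]
      · have hd : d r = μ := if_neg hr
        omega
    · rfl
  have hsum : ∑ r, d r = δ := by
    have hcard : ∑ r : Fin k, (if r.val < k * μ - δ then 1 else 0) = k * μ - δ := by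
      rw [Fin.sum_univ_eq_sum_range (fun r => if r < k * μ - δ then 1 else 0) k,
        ← Finset.sum_filter, Finset.sum_const, smul_eq_mul, mul_one]
      have : (Finset.range k).filter (· < k * μ - δ) = Finset.range (k * μ - δ) := by
        ext i
        simp only [Finset.mem_filter, Finset.mem_range]
        omega
      rw [this, Finset.card_range]
    have htot : ∑ r : Fin k, (d r + if r.val < k * μ - δ then 1 else 0) = k * μ := by
      rw [Finset.sum_congr rfl (g := fun _ => μ) fun r _ => by
        simp only [d]
        split_ifs <;> omega]
      simp
    rw [Finset.sum_add_distrib, hcard] at htot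
    omega
  have hpinj : Function.Injective p := by
    intro a b hab
    have hab' := hp a b
    have hba' := hp b a
    rw [← hab, hp] at hab'
    rw [hab, hp] at hba'
    by_contra hne
    have hne' : ¬ b = a := fun h => hne h.symm
    have : a.val ≠ b.val := fun h => hne (Fin.ext h)
    by_cases ha : a.val = 0 <;> by_cases hb : b.val = 0 <;> simp_all
  have h := intDeg_extDeg_of_leading_minor G d hdeg ⟨p ∘ ℓ, hpinj.comp hℓ.injective⟩
    (fun r => by simp [hlead, hp]) (by
      rw [Matrix.det_of_isUpperTriangular]
      · simp [hlead, hp]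
      · intro r s hrs
        have hrs' : ℓ s < ℓ r := hℓ hrs
        have h0 : (ℓ r).val ≠ 0 := by
          have : (ℓ s).val < (ℓ r).val := hrs'
          omega
        simp only [Matrix.of_apply, hlead, Function.Embedding.coeFn_mk, Function.comp_apply, hp]
        exact if_neg (by simp [h0, hrs'.ne']))
  rwa [hsum] at h

/-- The sum of a step function. -/
lemma sum_range_ite_lt (j L w : ℕ) :
    ∑ t ∈ Finset.range j, (if t < L then w else 0) = min j L * w := by
  rw [← Finset.sum_filter, Finset.sum_const, smul_eq_mul]
  have : (Finset.range j).filter (· < L) = Finset.range (min j L) := by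
    ext i
    simp
  rw [this, Finset.card_range]

lemma mul_le_sum_range (f : ℕ → ℕ) (j L w : ℕ) (hL : L ≤ j) (hf : ∀ t < L, w ≤ f t) :
    L * w ≤ ∑ t ∈ Finset.range j, f t := by
  calc L * w = ∑ t ∈ Finset.range j, (if t < L then w else 0) := by
        rw [sum_range_ite_lt, min_eq_right hL]
    _ ≤ _ := Finset.sum_le_sum fun t _ => by
        split_ifs with h
        · exact hf t h
        · exact Nat.zero_le _

/-- **Construction 2.** The `(q^{δ+k−1}, k, δ)` convolutional code obtained by stacking
the rows of a generator matrix of the first order Reed–Muller code `R(q, δ+k−1)` (whose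
first row is the all-one vector) into `G_0, …, G_μ` (with the first `kμ−δ` rows of `G_μ`
zero and its remaining rows the last rows of `R`) is a non-catastrophic `(n,k,δ)` code with
the stated column distances. -/
theorem stmt_15 {F : Type*} [Field F] [Fintype F] [DecidableEq F]
    (q k δ μ : ℕ) (hq : Fintype.card F = q)
    (hk : 2 ≤ k) (hδ : 1 ≤ δ)
    (hμ : μ = (δ + k - 1) / k)
    (R : Matrix (Fin (δ + k)) (Fin (q ^ (δ + k - 1))) F)
    (hR1 : ∀ j, R ⟨0, by omega⟩ j = 1)
    (hR2 : Function.Bijective fun j : Fin (q ^ (δ + k - 1)) =>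
        (fun r : Fin (δ + k - 1) => R ⟨r.val + 1, by have := r.isLt; omega⟩ j))
    (Gc : ℕ → Matrix (Fin k) (Fin (q ^ (δ + k - 1))) F)
    (hstack : ∀ i, i < μ → ∀ r : Fin k, Gc i r = rowPad R (i * k + r.val))
    (hzero : ∀ r : Fin k, r.val < k * μ - δ → Gc μ r = 0)
    (hlastrows : ∀ r : Fin k, k * μ - δ ≤ r.val → Gc μ r = rowPad R (r.val + δ))
    (G : Matrix (Fin k) (Fin (q ^ (δ + k - 1))) (Polynomial F))
    (hG : ∀ r c, G r c = ∑ i ∈ Finset.range (μ + 1), Polynomial.C (Gc i r c) * Polynomial.X ^ i) :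
    LinearIndependent (Polynomial F) (fun r => G r) ∧
    IsNoncatastrophic k (Submodule.span (Polynomial F) (Set.range fun r => G r)) ∧
    HasParams k δ (Submodule.span (Polynomial F) (Set.range fun r => G r)) ∧
    (δ % k ≠ k - 1 →
      ∀ j : ℕ, colDist (Submodule.span (Polynomial F) (Set.range fun r => G r)) j
        = (min j (δ / k) + 1) * q ^ (δ + k - 2) * (q - 1)) ∧
    (δ % k = k - 1 →
      (∀ j : ℕ, j ≤ δ / k →
        colDist (Submodule.span (Polynomial F) (Set.range fun r => G r)) j
          = (j + 1) * q ^ (δ + k - 2) * (q - 1)) ∧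
      (∀ j : ℕ, δ / k + 1 ≤ j →
        colDist (Submodule.span (Polynomial F) (Set.range fun r => G r)) j
          = q ^ (δ + k - 1) + (δ / k) * (q ^ (δ + k - 2) * (q - 1)))) := by
  have h1 : δ ≤ k * μ := by
    have := Nat.div_add_mod (δ + k - 1) k
    have := Nat.mod_lt (δ + k - 1) (show 0 < k by omega)
    rw [← hμ] at *
    omega
  have h2 : k * μ < δ + k := by
    have := Nat.mul_div_le (δ + k - 1) k
    rw [← hμ] at this
    omega
  clear hμ
  have hμ : 0 < μ := Nat.pos_of_ne_zero fun h => by simp [h] at h1; omega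
  have hm : 0 < δ + k := by omega
  obtain ⟨p, hp⟩ := exists_points_reedMuller hm R hR1 hR2
  obtain ⟨I, ρ, hI, hlow, htop⟩ := exists_stacking_index k δ μ (by omega) h1
  have hcomb := sum_smul_stacked R h2 I ρ hI hlow htop Gc hstack hzero hlastrows G hG
  obtain ⟨π, hπ⟩ := exists_retraction_stacked hm (by omega) R p hp I ρ
    (fun r a => by simpa using hlow 0 hμ r a) G hcomb
  obtain ⟨hli, hnc⟩ := isNoncatastrophic_of_retraction G π hπ
  have hcoeff : ∀ r c t, (G r c).coeff t = if t ≤ μ then Gc t r c else 0 := by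
    intro r c t
    simp [hG, finsetSum_coeff, coeff_X_pow]
  obtain ⟨hint, hext⟩ := intDeg_extDeg_stacked R hμ h1 h2 p hp Gc hstack hzero hlastrows G hcoeff
  refine ⟨hli, hnc, ⟨G, ⟨hli, rfl⟩, hint.trans hext.symm, hext⟩, ?_⟩
  have hwt : ∀ (a : Fin (δ + k) → F) (i : Fin (δ + k)), i.val ≠ 0 → a i ≠ 0 →
      hammingNorm (fun c => ∑ s, a s * R s c) = q ^ (δ + k - 2) * (q - 1) := by
    intro a i hi ha
    subst hq
    exact hammingNorm_reedMuller hm R hR1 hR2 a i hi ha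
  have hwt_const : ∀ (a : Fin (δ + k) → F), a ≠ 0 → (∀ i : Fin (δ + k), i.val ≠ 0 → a i = 0) →
      hammingNorm (fun c => ∑ s, a s * R s c) = q ^ (δ + k - 1) := by
    intro a ha hi
    have hz : ∀ s : Fin (δ + k), s ≠ ⟨0, hm⟩ → a s = 0 := fun s hs =>
      hi s fun h => hs (Fin.ext h)
    have h0 : a ⟨0, hm⟩ ≠ 0 := fun h => ha (funext fun s => by
      by_cases hs : s = ⟨0, hm⟩
      · rw [hs, h]; rfl
      · exact hz s hs)
    have : (fun c => ∑ s, a s * R s c) = fun _ => a ⟨0, hm⟩ := by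
      ext c
      rw [Finset.sum_eq_single ⟨0, hm⟩ (fun s _ hs => by simp [hz s hs]) (by simp), hR1, mul_one]
    rw [this]
    simp [hammingNorm, h0]
  set w := q ^ (δ + k - 2) * (q - 1) with hw
  have hq2 : 2 ≤ q := hq ▸ Fintype.one_lt_card
  have hnw : q ^ (δ + k - 1) = w + q ^ (δ + k - 2) := by
    obtain ⟨x, rfl⟩ : ∃ x, q = x + 1 := ⟨q - 1, by omega⟩
    have : δ + k - 1 = δ + k - 2 + 1 := by omega
    rw [hw, this, pow_succ]
    simp only [Nat.add_sub_cancel]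
    ring
  have hwge : q ^ (δ + k - 2) ≤ w := by
    rw [hw]
    exact Nat.le_mul_of_pos_right _ (by omega)
  have hwt_le : ∀ a : Fin (δ + k) → F, a ≠ 0 →
      w ≤ hammingNorm (fun c => ∑ s, a s * R s c) := by
    intro a ha
    by_cases h : ∃ i : Fin (δ + k), i.val ≠ 0 ∧ a i ≠ 0
    · obtain ⟨i, hi, hai⟩ := h
      exact (hwt a i hi hai).ge
    · push Not at h
      rw [hwt_const a ha h]
      omega
  have hrow : ∀ s : Fin (δ + k), s.val ≠ 0 → hammingNorm (R s) = w := by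
    intro s hs
    rw [← hwt (Pi.single s 1) s hs (by simp)]
    simp [Pi.single_apply]
  have hrow0 : hammingNorm (R ⟨0, hm⟩) = q ^ (δ + k - 1) := by
    simp [hammingNorm, hR1]
  have hcv : ∀ (u : Fin k → Polynomial F) t, coeffVec (∑ r, u r • G r) t =
      fun c => ∑ a, (X ^ I a * u (ρ a)).coeff t * R a c := by
    intro u t
    ext c
    simp only [coeffVec, hcomb, finsetSum_coeff, coeff_mul_C]
  have hcvG : ∀ r t, coeffVec (G r) t = if t ≤ μ then Gc t r else 0 := by
    intro r t
    ext c
    simp only [coeffVec, hcoeff]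
    split_ifs <;> rfl
  have hstart : ∀ u : Fin k → Polynomial F, coeffVec (∑ r, u r • G r) 0 ≠ 0 →
      ∃ a, I a = 0 ∧ (u (ρ a)).coeff 0 ≠ 0 := by
    intro u hu
    by_contra! hcon
    apply hu
    rw [hcv]
    ext c
    refine Finset.sum_eq_zero fun a _ => ?_
    by_cases ha : I a = 0
    · simp [ha, hcon a ha]
    · simp [mul_coeff_zero, Ne.symm ha]
  have hidx : ∀ t < μ, ∀ r : Fin k, ∃ a, I a = t ∧ ρ a = r ∧ a.val = t * k + r.val := by
    intro t ht r
    have hlt : t * k + r.val < δ + k := by nlinarith [r.isLt]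
    obtain ⟨h, h'⟩ := (hlow t ht r ⟨_, hlt⟩).mpr rfl
    exact ⟨⟨_, hlt⟩, h, h', rfl⟩
  have hidx_top : ∀ r : Fin k, k * μ - δ ≤ r.val → ∃ a, I a = μ ∧ ρ a = r := by
    intro r hr
    have hlt : r.val + δ < δ + k := by omega
    exact ⟨⟨_, hlt⟩, (htop r ⟨_, hlt⟩).mpr ⟨hr, rfl⟩⟩
  have hterm : ∀ (u : Fin k → Polynomial F) (r : Fin k) t, (u r).coeff 0 ≠ 0 →
      (∃ a, I a = t ∧ ρ a = r) → w ≤ hammingNorm (coeffVec (∑ r, u r • G r) t) := by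
    rintro u r t hr ⟨a, rfl, rfl⟩
    rw [hcv]
    refine hwt_le _ fun h => hr ?_
    have := congrFun h a
    simpa [coeff_X_pow_mul'] using this
  have hGnorm : ∀ r : Fin k, ∀ t < μ, t * k + r.val ≠ 0 → hammingNorm (coeffVec (G r) t) = w := by
    intro r t ht hne
    have hlt : t * k + r.val < δ + k := by nlinarith [r.isLt]
    rw [hcvG, if_pos ht.le, hstack t ht, rowPad, dif_pos hlt, hrow _ hne]
  have hGnorm_gt : ∀ r : Fin k, ∀ t > μ, hammingNorm (coeffVec (G r) t) = 0 := by
    intro r t ht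
    rw [hcvG, if_neg (not_le.mpr ht), hammingNorm_zero]
  have hGnorm_zero : ∀ r : Fin k, r.val < k * μ - δ → hammingNorm (coeffVec (G r) μ) = 0 := by
    intro r hr
    rw [hcvG, if_pos le_rfl, hzero r hr, hammingNorm_zero]
  have hGmem : ∀ r, G r ∈ Submodule.span (Polynomial F) (Set.range fun r => G r) := fun r =>
    Submodule.subset_span ⟨r, rfl⟩
  have hone : ∀ r : Fin k, r.val = 1 → ∀ t, (t < μ ∨ t = μ ∧ k * μ - δ = 0) →
      hammingNorm (coeffVec (G r) t) = w := by
    rintro r hr t (ht | ⟨rfl, he⟩)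
    · exact hGnorm r t ht (by omega)
    · have hlt : r.val + δ < δ + k := by omega
      rw [hcvG, if_pos le_rfl, hlastrows r (by omega), rowPad, dif_pos hlt, hrow _ (by simp; omega)]
  have hwpos : 0 < w := (Nat.pow_pos (by omega)).trans_le hwge
  have hdelta : δ / k + 1 = μ ∧ k * μ - δ ≠ 0 ∨ δ / k = μ ∧ k * μ - δ = 0 := by
    by_cases he : k * μ - δ = 0
    · right
      refine ⟨?_, he⟩
      have : δ = k * μ := by omega
      rw [this, Nat.mul_div_cancel_left _ (by omega)]
    · left
      refine ⟨le_antisymm (Nat.div_lt_of_lt_mul (by omega)) ?_, he⟩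
      have : (μ - 1) * k ≤ δ := by
        rw [Nat.sub_mul, one_mul, mul_comm]
        omega
      have := (Nat.le_div_iff_mul_le (by omega)).mpr this
      omega
  have hlevel : ∀ t ≤ δ / k, t < μ ∨ t = μ ∧ k * μ - δ = 0 := by
    intro t ht
    omega
  have hshort : ∀ j, (j ≤ δ / k ∨ k * μ - δ ≠ 1) →
      colDist (Submodule.span (Polynomial F) (Set.range fun r => G r)) j =
        (min j (δ / k) + 1) * w := by
    intro j hj
    refine IsLeast.csInf_eq ⟨⟨G ⟨1, hk⟩, hGmem _, ?_, ?_⟩, ?_⟩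
    · intro h0
      have := hone ⟨1, hk⟩ rfl 0 (Or.inl hμ)
      rw [h0, hammingNorm_zero] at this
      omega
    · have hval : ∀ t ∈ Finset.range (j + 1), hammingNorm (coeffVec (G ⟨1, hk⟩) t) =
          if t < δ / k + 1 then w else 0 := by
        intro t ht
        split_ifs with h
        · exact hone _ rfl t (hlevel t (by omega))
        · have := Finset.mem_range.mp ht
          rcases lt_or_ge μ t with hlt | hle
          · exact hGnorm_gt _ t hlt
          · obtain rfl : t = μ := by omega
            exact hGnorm_zero _ (show 1 < k * t - δ by omega)
      rw [Finset.sum_congr rfl hval, sum_range_ite_lt]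
      congr 1
      omega
    · rintro _ ⟨v, hv, hv0, rfl⟩
      obtain ⟨u, rfl⟩ := (Submodule.mem_span_range_iff_exists_fun _).mp hv
      obtain ⟨a, -, ha⟩ := hstart u hv0
      refine mul_le_sum_range _ _ _ _ (by omega) fun t ht => hterm u (ρ a) t ha ?_
      rcases hlevel t (by omega) with h | ⟨rfl, he⟩
      · obtain ⟨b, hb, hb', -⟩ := hidx t h (ρ a)
        exact ⟨b, hb, hb'⟩
      · exact hidx_top _ (by omega)
  have hmod : δ % k = k - 1 ↔ k * μ - δ = 1 := by
    have hdm := Nat.div_add_mod δ k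
    rcases hdelta with ⟨hL, he⟩ | ⟨hL, he⟩
    · rw [← hL, mul_add, mul_one] at h1 h2 ⊢
      omega
    · rw [hL] at hdm
      omega
  refine ⟨fun hne j => ?_, fun heq => ⟨fun j hj => ?_, fun j hj => ?_⟩⟩
  · rw [hshort j (Or.inr (by omega)), hw, mul_assoc]
  · rw [hshort j (Or.inl hj), hw, mul_assoc, min_eq_left hj]
  have he : k * μ - δ = 1 := hmod.mp heq
  have hdiv : δ / k + 1 = μ := by omega
  have hG0 : hammingNorm (coeffVec (G ⟨0, by omega⟩) 0) = q ^ (δ + k - 1) := by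
    rw [hcvG, if_pos hμ.le, hstack 0 hμ, rowPad, dif_pos (by simp; omega)]
    simpa using hrow0
  refine IsLeast.csInf_eq ⟨⟨G ⟨0, by omega⟩, hGmem _, ?_, ?_⟩, ?_⟩
  · intro h0
    rw [h0, hammingNorm_zero] at hG0
    omega
  · have hval : ∀ t ∈ Finset.range j, hammingNorm (coeffVec (G ⟨0, by omega⟩) (t + 1)) =
        if t < δ / k then w else 0 := by
      intro t ht
      split_ifs with h
      · refine hGnorm _ _ (by omega) ?_
        have : 0 < (t + 1) * k := Nat.mul_pos (by omega) (by omega)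
        omega
      · rcases lt_or_ge μ (t + 1) with hlt | hle
        · exact hGnorm_gt _ _ hlt
        · obtain rfl : t + 1 = μ := by omega
          exact hGnorm_zero _ (show 0 < k * (t + 1) - δ by omega)
    rw [Finset.sum_range_succ', Finset.sum_congr rfl hval, sum_range_ite_lt, hG0,
      min_eq_right (by omega), add_comm]
  · rintro _ ⟨v, hv, hv0, rfl⟩
    obtain ⟨u, rfl⟩ := (Submodule.mem_span_range_iff_exists_fun _).mp hv
    obtain ⟨a, hIa, ha⟩ := hstart u hv0
    have hlev : ∀ t < μ, w ≤ hammingNorm (coeffVec (∑ r, u r • G r) t) := by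
      intro t ht
      obtain ⟨b, hb, hb', -⟩ := hidx t ht (ρ a)
      exact hterm u (ρ a) t ha ⟨b, hb, hb'⟩
    by_cases hr : ∃ r : Fin k, r.val ≠ 0 ∧ (u r).coeff 0 ≠ 0
    · obtain ⟨r, hr, hur⟩ := hr
      have hsum := mul_le_sum_range (fun t => hammingNorm (coeffVec (∑ r, u r • G r) t))
        (j + 1) (μ + 1) w (by omega) (fun t ht => by
          rcases (Nat.lt_succ_iff.mp ht).lt_or_eq with h | rfl
          · exact hlev t h
          · exact hterm u r t hur (hidx_top r (by omega)))
      refine le_trans ?_ hsum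
      rw [← hdiv, add_mul, add_mul]
      omega
    · push Not at hr
      have hfirst : hammingNorm (coeffVec (∑ r, u r • G r) 0) = q ^ (δ + k - 1) := by
        rw [hcv]
        refine hwt_const _ (fun h => ha ?_) fun b hb => ?_
        · simpa [hIa] using congrFun h a
        · rw [mul_coeff_zero]
          by_cases hIb : I b = 0
          · rw [hr (ρ b) fun h0 => hb ?_, mul_zero]
            have := (hlow 0 hμ (ρ b) b).mp ⟨hIb, rfl⟩
            omega
          · simp [Ne.symm hIb]
      have hsum := mul_le_sum_range (fun t => hammingNorm (coeffVec (∑ r, u r • G r) (t + 1)))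
        j (δ / k) w (by omega) (fun t ht => hlev _ (by omega))
      rw [Finset.sum_range_succ', hfirst, add_comm]
      exact Nat.add_le_add_right hsum _
end
end
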